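/- Let γ be a probability measure on ℝ with γ ∈ 𝒯_q for some q > 1, and let σ be any Borel probability measure on 𝕊 whose n-th coordinate marginal equals σ_n for every n. Then for σ-almost every θ ∈ 𝕊, the sequence (W_θ^{(n,γ)})_{n∈ℕ} satisfies a large deviation principle with speed n and the convex good rate function 𝕀^q_{γ,μ₂} := (Ψ_{γ,μ₂})*, where Ψ_{γ,ν}(t) := ∫_ℝ log M_γ(t u) ν(du). -/

import Mathlib

open MeasureTheory Filter Topology Set ProbabilityTheory
open scoped ENNReal NNReal

noncomputable section

namespace LDP

/-- The nonnegative part of an extended real, as an extended nonnegative real. -/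
def erealToENNReal (x : EReal) : ℝ≥0∞ := if x = ⊤ then ⊤ else ENNReal.ofReal x.toReal

/-- Extended (possibly infinite) integral of an `EReal`-valued function:
positive part minus negative part. -/
def eIntegral (ν : Measure ℝ) (f : ℝ → EReal) : EReal :=
  ((∫⁻ u, erealToENNReal (f u) ∂ν : ℝ≥0∞) : EReal)
    - ((∫⁻ u, erealToENNReal (-f u) ∂ν : ℝ≥0∞) : EReal)

/-- `q`-th absolute moment of a measure on `ℝ`. -/
def mom (q : ℝ) (ν : Measure ℝ) : ℝ≥0∞ := ∫⁻ x, ENNReal.ofReal (|x| ^ q) ∂ν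

open Classical in
/-- Relative entropy `H(ν|μ)`. -/
def relEnt (ν μ : Measure ℝ) : EReal :=
  if ν ≪ μ then eIntegral ν (fun x => ENNReal.log (ν.rnDeriv μ x)) else ⊤

/-- The generalized normal distribution `μ_p` on `ℝ`. -/
def muP (p : ℝ) : Measure ℝ :=
  volume.withDensity fun y =>
    ENNReal.ofReal ((2 * p ^ (1/p) * Real.Gamma (1 + 1/p))⁻¹ * Real.exp (-(|y| ^ p) / p))

/-- The uniform probability measure `μ_∞` on `[-1,1]`. -/
def muInf : Measure ℝ := (volume (Icc (-1:ℝ) 1))⁻¹ • volume.restrict (Icc (-1:ℝ) 1)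

/-- Extended-real-valued log moment generating function of a measure on `ℝ`. -/
def logM (γ : Measure ℝ) (t : ℝ) : EReal :=
  ENNReal.log (∫⁻ y, ENNReal.ofReal (Real.exp (t * y)) ∂γ)

/-- The class `𝒯_q` of measures whose log mgf is dominated by `C|t|^{q/(q-1)} + C`. -/
def memT (q : ℝ) (γ : Measure ℝ) : Prop :=
  ∃ C : ℝ, ∀ t : ℝ, logM γ t ≤ ((C * |t| ^ (q/(q-1)) + C : ℝ) : EReal)

/-- Legendre transform of a function of one real variable. -/
def legendre1 (Λ : ℝ → EReal) (τ : ℝ) : EReal := ⨆ t : ℝ, ((t * τ : ℝ) : EReal) - Λ t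

/-- Legendre transform of a function of two real variables. -/
def legendre2 (Λ : ℝ × ℝ → EReal) (τ : ℝ × ℝ) : EReal :=
  ⨆ t : ℝ × ℝ, ((t.1 * τ.1 + t.2 * τ.2 : ℝ) : EReal) - Λ t

/-- Legendre transform of a function of three real variables. -/
def legendre3 (Λ : ℝ × ℝ × ℝ → EReal) (τ : ℝ × ℝ × ℝ) : EReal :=
  ⨆ t : ℝ × ℝ × ℝ, ((t.1 * τ.1 + t.2.1 * τ.2.1 + t.2.2 * τ.2.2 : ℝ) : EReal) - Λ t

/-- `Φ_p(t₀,t₁,t₂) = log ∫∫ exp(t₀ z² + t₁ z y + t₂ |y|^p) μ₂(dz) μ_p(dy)`. -/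
def Phi (p : ℝ) (t : ℝ × ℝ × ℝ) : EReal :=
  ENNReal.log (∫⁻ y, (∫⁻ z,
    ENNReal.ofReal (Real.exp (t.1 * z^2 + t.2.1 * z * y + t.2.2 * |y| ^ p)) ∂(muP 2)) ∂(muP p))

/-- The annealed rate function `𝕀ᵃ_p` for `p ∈ [2,∞)`. -/
def Ia (p : ℝ) (w : ℝ) : EReal :=
  ⨅ τ ∈ {τ : ℝ × ℝ × ℝ | 0 < τ.1 ∧ 0 < τ.2.2 ∧
      τ.1 ^ (-(1:ℝ)/2) * τ.2.1 * τ.2.2 ^ (-(1:ℝ)/p) = w},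
    legendre3 (Phi p) τ

/-- `Λ_p(t₁,t₂) = log ∫ exp(t₁ y + t₂|y|^p) μ_p(dy)`. -/
def LamP (p : ℝ) (t : ℝ × ℝ) : EReal :=
  ENNReal.log (∫⁻ y, ENNReal.ofReal (Real.exp (t.1 * y + t.2 * |y| ^ p)) ∂(muP p))

/-- `Ψ_{p,ν}(t₁,t₂) = ∫ Λ_p(t₁ u, t₂) ν(du)`. -/
def Psi (p : ℝ) (ν : Measure ℝ) (t : ℝ × ℝ) : EReal :=
  eIntegral ν (fun u => LamP p (t.1 * u, t.2))

/-- The quenched rate function `𝕀^q_{p,ν}`. -/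
def Iq (p : ℝ) (ν : Measure ℝ) (w : ℝ) : EReal :=
  ⨅ τ ∈ {τ : ℝ × ℝ | 0 < τ.2 ∧ τ.1 * τ.2 ^ (-(1:ℝ)/p) = w}, legendre2 (Psi p ν) τ

/-- The Cramér-type rate function `𝕀^{cr}_p`. -/
def Icr (p : ℝ) (w : ℝ) : EReal :=
  ⨅ τ ∈ {τ : ℝ × ℝ | 0 < τ.2 ∧ τ.1 * τ.2 ^ (-(1:ℝ)/p) = w}, legendre2 (LamP p) τ

/-- `Φ_γ(t₀,t₁) = log ∫∫ exp(t₀ z² + t₁ z x) μ₂(dz) γ(dx)`. -/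
def Phig (γ : Measure ℝ) (t : ℝ × ℝ) : EReal :=
  ENNReal.log (∫⁻ x, (∫⁻ z,
    ENNReal.ofReal (Real.exp (t.1 * z^2 + t.2 * z * x)) ∂(muP 2)) ∂γ)

/-- The annealed rate function `𝕀ᵃ_γ` for a product measure `γ^{⊗n}`. -/
def Iag (γ : Measure ℝ) (w : ℝ) : EReal :=
  ⨅ τ ∈ {τ : ℝ × ℝ | 0 < τ.1 ∧ τ.1 ^ (-(1:ℝ)/2) * τ.2 = w}, legendre2 (Phig γ) τ

/-- `Ψ_{γ,ν}(t) = ∫ log M_γ(t u) ν(du)`. -/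
def Psig (γ ν : Measure ℝ) (t : ℝ) : EReal := eIntegral ν (fun u => logM γ (t * u))

/-- The quenched rate function `𝕀^q_{γ,ν}` for a product measure. -/
def Iqg (γ ν : Measure ℝ) : ℝ → EReal := legendre1 (Psig γ ν)

/-- `Ψ_{∞,ν}`. -/
def PsiInf (ν : Measure ℝ) : ℝ → EReal := Psig muInf ν

/-- `𝕀^q_{∞,ν}`. -/
def IqInf (ν : Measure ℝ) : ℝ → EReal := legendre1 (PsiInf ν)

/-- `𝕀ᵃ_∞`. -/
def IaInf : ℝ → EReal := Iag muInf

/-- Euclidean inner product on `ℝⁿ`. -/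
def dotp {n : ℕ} (x y : Fin n → ℝ) : ℝ := ∑ i, x i * y i

/-- The unit ℓ^p ball of `ℝⁿ`. -/
def lpBall (n : ℕ) (p : ℝ) : Set (Fin n → ℝ) := {x | ∑ i, |x i| ^ p ≤ 1}

/-- The uniform probability measure on the unit ℓ^p ball. -/
def uniformLpBall (n : ℕ) (p : ℝ) : Measure (Fin n → ℝ) :=
  (volume (lpBall n p))⁻¹ • volume.restrict (lpBall n p)

/-- The unit Euclidean sphere in `ℝⁿ`. -/
def unitSphereSet (n : ℕ) : Set (Fin n → ℝ) := {x | ∑ i, (x i)^2 = 1}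

/-- `μ` is the (unique) rotation-invariant probability measure on the unit sphere `S^{n-1}`. -/
def IsUniformSphere {n : ℕ} (μ : Measure (Fin n → ℝ)) : Prop :=
  IsProbabilityMeasure μ ∧ μ (unitSphereSet n) = 1 ∧
    ∀ O : Matrix.orthogonalGroup (Fin n) ℝ,
      Measure.map (fun x => (O : Matrix (Fin n) (Fin n) ℝ).mulVec x) μ = μ

/-- A large deviation principle with speed `s` and rate function `I`. -/
def IsLDP {Ω : Type*} [MeasurableSpace Ω] (P : Measure Ω)
    (ξ : ℕ → Ω → ℝ) (s : ℕ → ℝ) (I : ℝ → EReal) : Prop :=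
  LowerSemicontinuous I ∧
    ∀ Γ : Set ℝ, MeasurableSet Γ →
      (-(⨅ x ∈ interior Γ, I x) ≤
        atTop.liminf fun n =>
          (((s n)⁻¹ : ℝ) : EReal) * ENNReal.log (P {ω | ξ n ω ∈ interior Γ})) ∧
      ((atTop.limsup fun n =>
          (((s n)⁻¹ : ℝ) : EReal) * ENNReal.log (P {ω | ξ n ω ∈ closure Γ})) ≤
        -(⨅ x ∈ closure Γ, I x))

/-- Goodness of a rate function: compact sublevel sets. -/
def HasCompactSublevels (I : ℝ → EReal) : Prop := ∀ c : ℝ, IsCompact {x | I x ≤ (c : EReal)}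

/-- Quasiconvexity: convex sublevel sets. -/
def QuasiconvexRate (I : ℝ → EReal) : Prop := ∀ c : EReal, Convex ℝ {x | I x ≤ c}

/-- Symmetry: `I(-w) = I(w)`. -/
def SymmetricRate (I : ℝ → EReal) : Prop := ∀ w : ℝ, I (-w) = I w

/-- Convexity of an extended-real-valued rate function. -/
def ConvexRate (I : ℝ → EReal) : Prop :=
  ∀ x y a b : ℝ, 0 ≤ a → 0 ≤ b → a + b = 1 →
    I (a * x + b * y) ≤ (a : EReal) * I x + (b : EReal) * I y

/-- Convexity on a set, for extended-real-valued functions. -/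
def ConvexOnE (s : Set ℝ) (g : ℝ → EReal) : Prop :=
  ∀ x ∈ s, ∀ y ∈ s, ∀ a b : ℝ, 0 ≤ a → 0 ≤ b → a + b = 1 →
    g (a * x + b * y) ≤ (a : EReal) * g x + (b : EReal) * g y

/-- Concavity on a set, for extended-real-valued functions. -/
def ConcaveOnE (s : Set ℝ) (g : ℝ → EReal) : Prop :=
  ∀ x ∈ s, ∀ y ∈ s, ∀ a b : ℝ, 0 ≤ a → 0 ≤ b → a + b = 1 →
    (a : EReal) * g x + (b : EReal) * g y ≤ g (a * x + b * y)

/-- Strict convexity, for extended-real-valued functions. -/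
def StrictConvexE (g : ℝ → EReal) : Prop :=
  ∀ x y : ℝ, x ≠ y → ∀ a b : ℝ, 0 < a → 0 < b → a + b = 1 →
    g (a * x + b * y) < (a : EReal) * g x + (b : EReal) * g y

/-- The property of agreeing with a real affine function on a set. -/
def AffineOnE (s : Set ℝ) (g : ℝ → EReal) : Prop :=
  ∃ m q : ℝ, ∀ t ∈ s, g t = ((m * t + q : ℝ) : EReal)

/-- Empirical measure `L_{n,θ} = (1/n) Σ δ_{√n θ_i}`. -/
def empMeas (n : ℕ) (θn : Fin n → ℝ) : Measure ℝ :=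
  ((n : ℝ≥0∞))⁻¹ • ∑ i : Fin n, Measure.dirac (Real.sqrt n * θn i)

end LDP

open LDP

section GartnerEllis

variable {Ω : Type*} [MeasurableSpace Ω] {P : Measure Ω} [IsProbabilityMeasure P]
  {ξ : ℕ → Ω → ℝ} {Ψ : ℝ → ℝ}

/-- Exponential tilting: the tilted mass of a half-line away from the tilted mean is
eventually negligible. -/
lemma eventually_setIntegral_exp_le
    (hξ : ∀ n, Measurable (ξ n))
    (hint : ∀ n t, Integrable (fun ω => Real.exp (t * ξ n ω)) P)
    (hlim : ∀ t, Tendsto (fun n : ℕ => (n : ℝ)⁻¹ * cgf (ξ n) P (n * t)) atTop (𝓝 (Ψ t)))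
    {t s z : ℝ} (hs : Ψ (t + s) - Ψ t - s * z < 0) :
    ∀ᶠ n : ℕ in atTop,
      ∫ ω in {ω | s * z ≤ s * ξ n ω}, Real.exp (n * t * ξ n ω) ∂P
        ≤ mgf (ξ n) P (n * t) / 4 := by
  have h1 : Tendsto (fun n : ℕ => (n : ℝ)⁻¹ * cgf (ξ n) P (n * (t + s))
      - (n : ℝ)⁻¹ * cgf (ξ n) P (n * t) - s * z) atTop (𝓝 (Ψ (t + s) - Ψ t - s * z)) :=
    ((hlim (t + s)).sub (hlim t)).sub_const _
  set c := (Ψ (t + s) - Ψ t - s * z) / 2 with hc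
  have hc0 : c < 0 := by linarith
  have h2 := h1.eventually_lt_const (show Ψ (t + s) - Ψ t - s * z < c by linarith)
  have h3 : Tendsto (fun n : ℕ => (n : ℝ) * c) atTop atBot :=
    tendsto_natCast_atTop_atTop.atTop_mul_const_of_neg hc0
  have h4 := h3.eventually_lt_atBot (Real.log (1 / 4))
  filter_upwards [h2, h4, eventually_gt_atTop 0] with n hn hn4 hn0
  have hn0' : (0 : ℝ) < n := by exact_mod_cast hn0
  have e1 : ∫ ω in {ω | s * z ≤ s * ξ n ω}, Real.exp (n * t * ξ n ω) ∂P
      ≤ ∫ ω in {ω | s * z ≤ s * ξ n ω},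
        Real.exp (-(n * (s * z))) * Real.exp (n * (t + s) * ξ n ω) ∂P := by
    refine setIntegral_mono_on (hint n _).integrableOn
      ((hint n _).const_mul _).integrableOn
      (measurableSet_le measurable_const ((hξ n).const_mul s)) fun ω hω => ?_
    rw [← Real.exp_add]
    apply Real.exp_le_exp.2
    have := mul_le_mul_of_nonneg_left (show s * z ≤ s * ξ n ω from hω) hn0'.le
    linarith
  have e2 : ∫ ω in {ω | s * z ≤ s * ξ n ω},
        Real.exp (-(n * (s * z))) * Real.exp (n * (t + s) * ξ n ω) ∂P
      ≤ Real.exp (-(n * (s * z))) * mgf (ξ n) P (n * (t + s)) := by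
    rw [mgf, ← integral_const_mul]
    exact setIntegral_le_integral ((hint n _).const_mul _)
      (ae_of_all _ fun ω => by positivity)
  refine (e1.trans e2).trans ?_
  rw [← exp_cgf (hint n _), ← exp_cgf (hint n _), ← Real.exp_add]
  have e3 : Real.exp (cgf (ξ n) P (n * t)) / 4
      = Real.exp (cgf (ξ n) P (n * t) + Real.log (1 / 4)) := by
    rw [Real.exp_add, Real.exp_log (by norm_num)]; ring
  rw [e3]
  apply Real.exp_le_exp.2
  have e4 := mul_lt_mul_of_pos_left hn hn0'
  have e5 : (n : ℝ) * ((n : ℝ)⁻¹ * cgf (ξ n) P (n * (t + s))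
      - (n : ℝ)⁻¹ * cgf (ξ n) P (n * t) - s * z)
      = cgf (ξ n) P (n * (t + s)) - cgf (ξ n) P (n * t) - n * (s * z) := by
    field_simp
  linarith

/-- Local form of the Gärtner–Ellis lower bound at an exposed point `y = Ψ'(t)`. -/
lemma eventually_exp_le_measure_ball
    (hξ : ∀ n, Measurable (ξ n))
    (hint : ∀ n t, Integrable (fun ω => Real.exp (t * ξ n ω)) P)
    (hlim : ∀ t, Tendsto (fun n : ℕ => (n : ℝ)⁻¹ * cgf (ξ n) P (n * t)) atTop (𝓝 (Ψ t)))
    {t y δ a : ℝ} (hy : HasDerivAt Ψ y t) (hδ : 0 < δ) (ha : a < Ψ t - t * y - |t| * δ) :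
    ∀ᶠ n : ℕ in atTop, Real.exp (n * a) ≤ P.real {ω | |ξ n ω - y| < δ} := by
  have key : ∀ᶠ s in 𝓝 (0 : ℝ), |Ψ (t + s) - Ψ t - s * y| ≤ δ / 2 * |s| := by
    have := (hasDerivAt_iff_isLittleO_nhds_zero.1 hy).def (half_pos hδ)
    simpa using this
  obtain ⟨r, hr, hball⟩ := Metric.eventually_nhds_iff.1 key
  have hs1 := hball (y := r / 2) (by simp [abs_of_pos hr]; linarith)
  have hs2 := hball (y := -(r / 2)) (by simp [abs_of_pos hr]; linarith)
  rw [abs_neg] at hs2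
  rw [abs_of_pos (half_pos hr), abs_le] at hs1 hs2
  have hrδ : 0 < r * δ := by positivity
  have A1 := eventually_setIntegral_exp_le (P := P) hξ hint hlim (t := t) (s := r / 2)
    (z := y + δ) (by nlinarith [hs1.2])
  have A2 := eventually_setIntegral_exp_le (P := P) hξ hint hlim (t := t) (s := -(r / 2))
    (z := y - δ) (by nlinarith [hs2.2])
  set b := Ψ t - t * y - |t| * δ with hb
  have A3 := (hlim t).eventually_const_lt (show Ψ t - (b - a) / 2 < Ψ t by linarith)
  have h3 : Tendsto (fun n : ℕ => (n : ℝ) * (-((b - a) / 2))) atTop atBot :=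
    tendsto_natCast_atTop_atTop.atTop_mul_const_of_neg (by linarith)
  have A4 := h3.eventually_lt_atBot (Real.log (1 / 2))
  filter_upwards [A1, A2, A3, A4, eventually_gt_atTop 0] with n h1 h2 h3 h4 hn0
  have hn0' : (0 : ℝ) < n := by exact_mod_cast hn0
  set f := fun ω => Real.exp (n * t * ξ n ω) with hf
  have hfi : Integrable f P := hint n (n * t)
  set S1 := {ω | r / 2 * (y + δ) ≤ r / 2 * ξ n ω} with hS1
  set S2 := {ω | -(r / 2) * (y - δ) ≤ -(r / 2) * ξ n ω} with hS2
  set B := {ω | |ξ n ω - y| < δ} with hB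
  have mS1 : MeasurableSet S1 := measurableSet_le measurable_const ((hξ n).const_mul _)
  have mS2 : MeasurableSet S2 := measurableSet_le measurable_const ((hξ n).const_mul _)
  have mB : MeasurableSet B := measurableSet_lt
    (by simpa using ((hξ n).sub_const y).abs) measurable_const
  have htot : mgf (ξ n) P (n * t) ≤ (∫ ω in S1, f ω ∂P) + (∫ ω in S2, f ω ∂P)
      + ∫ ω in B, f ω ∂P := by
    rw [← integral_indicator mS1, ← integral_indicator mS2, ← integral_indicator mB,
      ← integral_add' (hfi.indicator mS1) (hfi.indicator mS2), ← integral_add'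
        ((hfi.indicator mS1).add (hfi.indicator mS2)) (hfi.indicator mB)]
    refine integral_mono hfi (((hfi.indicator mS1).add (hfi.indicator mS2)).add
      (hfi.indicator mB)) fun ω => ?_
    have p1 : 0 ≤ S1.indicator f ω := indicator_nonneg (fun _ _ => (Real.exp_pos _).le) _
    have p2 : 0 ≤ S2.indicator f ω := indicator_nonneg (fun _ _ => (Real.exp_pos _).le) _
    have p3 : 0 ≤ B.indicator f ω := indicator_nonneg (fun _ _ => (Real.exp_pos _).le) _
    change f ω ≤ S1.indicator f ω + S2.indicator f ω + B.indicator f ω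
    by_cases hω : ω ∈ B
    · rw [indicator_of_mem hω]; linarith
    · have hω' : δ ≤ |ξ n ω - y| := not_lt.1 hω
      rcases le_abs.1 hω' with h | h
      · have : ω ∈ S1 := by
          change r / 2 * (y + δ) ≤ r / 2 * ξ n ω
          nlinarith
        rw [indicator_of_mem this]; linarith
      · have : ω ∈ S2 := by
          change -(r / 2) * (y - δ) ≤ -(r / 2) * ξ n ω
          nlinarith
        rw [indicator_of_mem this]; linarith
  have hBint : ∫ ω in B, f ω ∂P ≤ Real.exp (n * (t * y + |t| * δ)) * P.real B := by
    have : ∫ ω in B, f ω ∂P ≤ ∫ ω in B, Real.exp (n * (t * y + |t| * δ)) ∂P := by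
      refine setIntegral_mono_on hfi.integrableOn (integrable_const _) mB fun ω hω => ?_
      apply Real.exp_le_exp.2
      have e1 : t * (ξ n ω - y) ≤ |t| * δ := by
        refine (le_abs_self _).trans ?_
        rw [abs_mul]
        exact mul_le_mul_of_nonneg_left (le_of_lt hω) (abs_nonneg t)
      have := mul_le_mul_of_nonneg_left e1 hn0'.le
      linarith
    refine this.trans_eq ?_
    rw [setIntegral_const, smul_eq_mul, mul_comm]
  have hfin : mgf (ξ n) P (n * t) / 2 ≤ Real.exp (n * (t * y + |t| * δ)) * P.real B := by
    linarith
  rw [← exp_cgf (hint n _)] at hfin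
  have h3' := mul_lt_mul_of_pos_left h3 hn0'
  rw [← mul_assoc (n : ℝ) (n : ℝ)⁻¹, mul_inv_cancel₀ hn0'.ne', one_mul] at h3'
  have e3 : Real.exp (n * a + n * (t * y + |t| * δ))
      ≤ Real.exp (cgf (ξ n) P (n * t)) / 2 := by
    have e3 : Real.exp (cgf (ξ n) P (n * t)) / 2
        = Real.exp (cgf (ξ n) P (n * t) + Real.log (1 / 2)) := by
      rw [Real.exp_add, Real.exp_log (by norm_num)]; ring
    rw [e3]
    apply Real.exp_le_exp.2
    have : (n : ℝ) * (Ψ t - (b - a) / 2) + n * (-((b - a) / 2))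
      = n * a + n * (t * y + |t| * δ) := by rw [hb]; ring
    linarith
  rw [Real.exp_add] at e3
  have := e3.trans hfin
  rw [mul_comm] at this
  exact le_of_mul_le_mul_left this (Real.exp_pos _)

/-- Chernoff bound in Gärtner–Ellis form, for the half-line beyond `b` as seen from `0`. -/
lemma eventually_measure_le_exp
    (hint : ∀ n t, Integrable (fun ω => Real.exp (t * ξ n ω)) P)
    (hlim : ∀ t, Tendsto (fun n : ℕ => (n : ℝ)⁻¹ * cgf (ξ n) P (n * t)) atTop (𝓝 (Ψ t)))
    (hΨ : ∀ t, 0 ≤ Ψ t) {b c t : ℝ} (hc : 0 ≤ c) (hct : c < t * b - Ψ t) :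
    ∀ᶠ n : ℕ in atTop, P.real {ω | b * b ≤ b * ξ n ω} ≤ Real.exp (-(n * c)) := by
  have htb : 0 < t * b := by linarith [hΨ t]
  have A := (hlim t).eventually_lt_const (show Ψ t < t * b - c by linarith)
  filter_upwards [A, eventually_gt_atTop 0] with n hn hn0
  have hn0' : (0 : ℝ) < n := by exact_mod_cast hn0
  have hsub : {ω | b * b ≤ b * ξ n ω} ⊆ {ω | t * b ≤ t * ξ n ω} := by
    intro ω hω
    have hω : b * b ≤ b * ξ n ω := hω
    change t * b ≤ t * ξ n ω
    rcases lt_trichotomy b 0 with hb | hb | hb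
    · nlinarith [neg_of_mul_pos_left htb hb.le, (mul_le_mul_left_of_neg hb).1 hω]
    · simp [hb] at htb
    · nlinarith [pos_of_mul_pos_left htb hb.le, le_of_mul_le_mul_left hω hb]
  refine (measureReal_mono hsub).trans ?_
  have h1 : {ω | t * b ≤ t * ξ n ω} = {ω | n * (t * b) ≤ n * t * ξ n ω} := by
    ext ω
    simp only [mem_ofPred_eq, mul_assoc]
    exact (mul_le_mul_iff_right₀ hn0').symm
  have h2 := measure_ge_le_exp_cgf (μ := P) (X := fun ω => n * t * ξ n ω) (t := 1)
    (n * (t * b)) zero_le_one (by simpa using hint n (n * t))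
  rw [h1]
  refine h2.trans (Real.exp_le_exp.2 ?_)
  have h3 : cgf (fun ω => n * t * ξ n ω) P 1 = cgf (ξ n) P (n * t) := by
    simp [cgf, mgf]
  rw [h3]
  have h4 := mul_lt_mul_of_pos_left hn hn0'
  rw [← mul_assoc (n : ℝ) (n : ℝ)⁻¹, mul_inv_cancel₀ hn0'.ne', one_mul] at h4
  linarith

end GartnerEllis

section Legendre

variable {Ψ : ℝ → ℝ}

lemma legendre1_coe_eq (x : ℝ) :
    legendre1 (fun t => (Ψ t : EReal)) x = ⨆ t : ℝ, ((t * x - Ψ t : ℝ) : EReal) := by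
  simp [legendre1, EReal.coe_sub]

lemma legendre1_nonneg (h0 : Ψ 0 = 0) (x : ℝ) : 0 ≤ legendre1 (fun t => (Ψ t : EReal)) x := by
  rw [legendre1_coe_eq]
  refine le_trans ?_ (le_iSup _ (0 : ℝ))
  simp [h0]

lemma lowerSemicontinuous_legendre1 :
    LowerSemicontinuous (legendre1 (fun t => (Ψ t : EReal))) := by
  have : legendre1 (fun t => (Ψ t : EReal))
      = fun x => ⨆ t : ℝ, ((t * x - Ψ t : ℝ) : EReal) := funext legendre1_coe_eq
  rw [this]
  refine lowerSemicontinuous_iSup fun t => Continuous.lowerSemicontinuous ?_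
  exact continuous_coe_real_ereal.comp (by fun_prop)

lemma convexRate_legendre1 (h0 : Ψ 0 = 0) :
    ConvexRate (legendre1 (fun t => (Ψ t : EReal))) := by
  intro x y a b ha hb hab
  have hx := legendre1_nonneg h0 x
  have hy := legendre1_nonneg h0 y
  rw [legendre1_coe_eq]
  refine iSup_le fun t => ?_
  have e : ((t * (a * x + b * y) - Ψ t : ℝ) : EReal)
      = (a : EReal) * ((t * x - Ψ t : ℝ) : EReal) + (b : EReal) * ((t * y - Ψ t : ℝ) : EReal) := by
    norm_cast
    have : Ψ t = (a + b) * Ψ t := by rw [hab, one_mul]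
    linear_combination -this
  rw [e]
  refine add_le_add (mul_le_mul_of_nonneg_left ?_ (by exact_mod_cast ha))
    (mul_le_mul_of_nonneg_left ?_ (by exact_mod_cast hb)) <;>
  · rw [legendre1_coe_eq]
    exact le_iSup (fun t : ℝ => ((t * _ - Ψ t : ℝ) : EReal)) t

lemma hasCompactSublevels_legendre1 :
    HasCompactSublevels (legendre1 (fun t => (Ψ t : EReal))) := by
  intro c
  have hcl : IsClosed {x | legendre1 (fun t => (Ψ t : EReal)) x ≤ (c : EReal)} :=
    lowerSemicontinuous_legendre1.isClosed_preimage _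
  refine isCompact_Icc.of_isClosed_subset hcl
    (s := Icc (-(c + Ψ (-1))) (c + Ψ 1)) fun x hx => ?_
  have hx : legendre1 (fun t => (Ψ t : EReal)) x ≤ (c : EReal) := hx
  rw [legendre1_coe_eq] at hx
  have h1 := (le_iSup (fun t : ℝ => ((t * x - Ψ t : ℝ) : EReal)) 1).trans hx
  have h2 := (le_iSup (fun t : ℝ => ((t * x - Ψ t : ℝ) : EReal)) (-1)).trans hx
  rw [EReal.coe_le_coe_iff] at h1 h2
  constructor <;> linarith

/-- Exposed points are dense below the graph of the Legendre transform: every point of its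
effective domain is approximated by points `Ψ'(t)` with no larger value. -/
lemma exists_hasDerivAt_near (h0 : Ψ 0 = 0) (hd : Differentiable ℝ Ψ) {x r ε : ℝ}
    (hr : ∀ t, t * x - Ψ t ≤ r) (hε : 0 < ε) :
    ∃ t y, HasDerivAt Ψ y t ∧ |y - x| < ε ∧ t * y - Ψ t ≤ r := by
  have hr0 : 0 ≤ r := by simpa [h0] using hr 0
  set κ := ε ^ 2 / (2 * r + 1) / 2 with hκ
  have hκ0 : 0 < κ := by positivity
  set F : ℝ → ℝ := fun t => Ψ t - t * x + κ * t ^ 2 / 2 with hF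
  have hFd : ∀ t, HasDerivAt F (deriv Ψ t - x + κ * t) t := by
    intro t
    have := ((hd t).hasDerivAt.sub ((hasDerivAt_id t).mul_const x)).add
      ((((hasDerivAt_id t).pow 2).const_mul κ).div_const 2)
    refine this.congr_deriv ?_
    simp
    ring
  have hFc : Continuous F := continuous_iff_continuousAt.2 fun t => (hFd t).continuousAt
  have hcoer : Tendsto F (cocompact ℝ) atTop := by
    have h1 : Tendsto (fun t : ℝ => κ / 2 * ‖t‖ ^ 2 - r) (cocompact ℝ) atTop :=
      tendsto_atTop_add_const_right _ _
        (((tendsto_pow_atTop two_ne_zero).comp tendsto_norm_cocompact_atTop).const_mul_atTop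
          (half_pos hκ0))
    refine tendsto_atTop_mono (fun t => ?_) h1
    have := hr t
    simp only [hF, Real.norm_eq_abs, sq_abs]
    linarith
  obtain ⟨t, ht⟩ := hFc.exists_forall_le hcoer
  have hcrit : deriv Ψ t - x + κ * t = 0 :=
    IsLocalMin.hasDerivAt_eq_zero (Filter.Eventually.of_forall ht) (hFd t)
  have h00 : F t ≤ 0 := by simpa [hF, h0] using ht 0
  refine ⟨t, deriv Ψ t, (hd t).hasDerivAt, ?_, ?_⟩
  · have e : deriv Ψ t - x = -(κ * t) := by linarith
    rw [e, abs_neg]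
    apply abs_lt_of_sq_lt_sq _ hε.le
    have h1 : κ * t ^ 2 ≤ 2 * r := by
      have := hr t
      simp only [hF] at h00
      linarith
    have h2 : κ * (2 * r + 1) = ε ^ 2 / 2 := by rw [hκ]; field_simp
    have : (κ * t) ^ 2 = κ * (κ * t ^ 2) := by ring
    nlinarith [mul_le_mul_of_nonneg_left h1 hκ0.le, sq_pos_of_pos hε]
  · have e : deriv Ψ t = x - κ * t := by linarith
    have := hr t
    rw [e]
    nlinarith [mul_nonneg hκ0.le (sq_nonneg t)]

end Legendre

lemma inv_mul_log_ofReal_exp {n : ℕ} (hn : 0 < n) (a : ℝ) :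
    (((n : ℝ)⁻¹ : ℝ) : EReal) * ENNReal.log (ENNReal.ofReal (Real.exp (n * a))) = (a : EReal) := by
  have hn' : (n : ℝ) ≠ 0 := by positivity
  rw [ENNReal.log_ofReal_of_pos (Real.exp_pos _), Real.log_exp, ← EReal.coe_mul]
  congr 1
  field_simp

lemma inv_mul_log_mono (n : ℕ) {a b : ℝ≥0∞} (h : a ≤ b) :
    (((n : ℝ)⁻¹ : ℝ) : EReal) * ENNReal.log a ≤ (((n : ℝ)⁻¹ : ℝ) : EReal) * ENNReal.log b :=
  mul_le_mul_of_nonneg_left (ENNReal.log_monotone h)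
    (by exact_mod_cast inv_nonneg.2 (Nat.cast_nonneg n))

section GartnerEllis

variable {Ω : Type*} [MeasurableSpace Ω] {P : Measure Ω} [IsProbabilityMeasure P]
  {ξ : ℕ → Ω → ℝ} {Ψ : ℝ → ℝ}

lemma gartnerEllis_lower (hξ : ∀ n, Measurable (ξ n))
    (hint : ∀ n t, Integrable (fun ω => Real.exp (t * ξ n ω)) P)
    (hlim : ∀ t, Tendsto (fun n : ℕ => (n : ℝ)⁻¹ * cgf (ξ n) P (n * t)) atTop (𝓝 (Ψ t)))
    (h0 : Ψ 0 = 0) (hd : Differentiable ℝ Ψ) {U : Set ℝ} (hU : IsOpen U) {x : ℝ} (hx : x ∈ U) :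
    -legendre1 (fun t => (Ψ t : EReal)) x ≤ atTop.liminf fun n : ℕ =>
      (((n : ℝ)⁻¹ : ℝ) : EReal) * ENNReal.log (P {ω | ξ n ω ∈ U}) := by
  rcases eq_or_ne (legendre1 (fun t => (Ψ t : EReal)) x) ⊤ with htop | htop
  · simp [htop]
  have hnb : legendre1 (fun t => (Ψ t : EReal)) x ≠ ⊥ :=
    ne_bot_of_le_ne_bot EReal.zero_ne_bot (legendre1_nonneg h0 x)
  obtain ⟨r, hr⟩ : ∃ r : ℝ, legendre1 (fun t => (Ψ t : EReal)) x = r :=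
    ⟨_, (EReal.coe_toReal htop hnb).symm⟩
  have hrt : ∀ t, t * x - Ψ t ≤ r := by
    intro t
    rw [legendre1_coe_eq] at hr
    have := (le_iSup (fun t : ℝ => ((t * x - Ψ t : ℝ) : EReal)) t).trans hr.le
    exact_mod_cast this
  rw [hr, ← EReal.coe_neg]
  refine EReal.ge_of_forall_gt_iff_ge.1 fun a ha => ?_
  have ha : a < -r := by exact_mod_cast ha
  obtain ⟨ε, hε, hball⟩ := Metric.isOpen_iff.1 hU x hx
  obtain ⟨t, y, hy, hyx, hty⟩ := exists_hasDerivAt_near h0 hd hrt (half_pos hε)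
  set δ := min (ε / 2) ((-r - a) / 2 / (|t| + 1)) with hδdef
  have hδ : 0 < δ := lt_min (half_pos hε) (div_pos (by linarith) (by positivity))
  have hδ1 : δ ≤ ε / 2 := min_le_left _ _
  have hδ2 : |t| * δ ≤ (-r - a) / 2 := by
    have h1 : δ ≤ (-r - a) / 2 / (|t| + 1) := min_le_right _ _
    rw [le_div_iff₀ (by positivity)] at h1
    nlinarith [abs_nonneg t]
  refine le_liminf_of_le (by isBoundedDefault) ?_
  filter_upwards [eventually_exp_le_measure_ball hξ hint hlim hy hδ (a := a) (by linarith),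
    eventually_gt_atTop 0] with n hn hn0
  rw [← inv_mul_log_ofReal_exp hn0 a]
  refine inv_mul_log_mono n ?_
  refine (ENNReal.ofReal_le_ofReal hn).trans ?_
  rw [ofReal_measureReal]
  refine measure_mono fun ω hω => hball ?_
  have hω : |ξ n ω - y| < δ := hω
  rw [Metric.mem_ball, Real.dist_eq]
  calc |ξ n ω - x| ≤ |ξ n ω - y| + |y - x| := abs_sub_le _ _ _
    _ < ε := by linarith

lemma eventually_measure_inter_le_exp
    (hint : ∀ n t, Integrable (fun ω => Real.exp (t * ξ n ω)) P)
    (hlim : ∀ t, Tendsto (fun n : ℕ => (n : ℝ)⁻¹ * cgf (ξ n) P (n * t)) atTop (𝓝 (Ψ t)))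
    (hΨ : ∀ t, 0 ≤ Ψ t) {c b : ℝ} (hc : 0 ≤ c) {F G : Set ℝ}
    (hb : (c : EReal) < legendre1 (fun t => (Ψ t : EReal)) b)
    (hFG : ∀ x ∈ F ∩ G, b * b ≤ b * x) :
    ∀ᶠ n : ℕ in atTop, P.real {ω | ξ n ω ∈ F ∩ G} ≤ Real.exp (-(n * c)) := by
  rw [legendre1_coe_eq] at hb
  obtain ⟨t, ht⟩ := lt_iSup_iff.1 hb
  have ht : c < t * b - Ψ t := by exact_mod_cast ht
  filter_upwards [eventually_measure_le_exp hint hlim hΨ hc ht] with n hn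
  have hsub : {ω | ξ n ω ∈ F ∩ G} ⊆ {ω | b * b ≤ b * ξ n ω} := fun ω hω => hFG _ hω
  exact (measureReal_mono hsub).trans hn

lemma gartnerEllis_upper
    (hint : ∀ n t, Integrable (fun ω => Real.exp (t * ξ n ω)) P)
    (hlim : ∀ t, Tendsto (fun n : ℕ => (n : ℝ)⁻¹ * cgf (ξ n) P (n * t)) atTop (𝓝 (Ψ t)))
    (hΨ : ∀ t, 0 ≤ Ψ t) {F : Set ℝ} (hF : IsClosed F) :
    (atTop.limsup fun n : ℕ =>
      (((n : ℝ)⁻¹ : ℝ) : EReal) * ENNReal.log (P {ω | ξ n ω ∈ F}))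
      ≤ -⨅ x ∈ F, legendre1 (fun t => (Ψ t : EReal)) x := by
  set I := legendre1 (fun t => (Ψ t : EReal)) with hI
  rw [EReal.le_neg]
  refine EReal.ge_of_forall_gt_iff_ge.1 fun c hc => ?_
  rw [EReal.le_neg, ← EReal.coe_neg]
  have hcF : ∀ x ∈ F, (c : EReal) < I x := fun x hx => hc.trans_le (iInf₂_le x hx)
  rcases lt_or_ge c 0 with hc0 | hc0
  · refine limsup_le_of_le (by isBoundedDefault) (Eventually.of_forall fun n => ?_)
    refine (inv_mul_log_mono n prob_le_one).trans ?_
    rw [ENNReal.log_one, mul_zero]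
    exact_mod_cast (neg_pos.2 hc0).le
  have h0F : (0 : ℝ) ∉ F := by
    intro h
    have h1 := hcF 0 h
    rw [hI, legendre1_coe_eq] at h1
    obtain ⟨t, ht⟩ := lt_iSup_iff.1 h1
    have ht : c < t * 0 - Ψ t := by exact_mod_cast ht
    linarith [hΨ t]
  have hpos : ∀ᶠ n : ℕ in atTop, P.real {ω | ξ n ω ∈ F ∩ Ici 0} ≤ Real.exp (-(n * c)) := by
    rcases (F ∩ Ici 0).eq_empty_or_nonempty with he | hne
    · simp [he, Real.exp_nonneg]
    · have hbdd : BddBelow (F ∩ Ici 0) := ⟨0, fun x hx => hx.2⟩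
      have hmem := (hF.inter isClosed_Ici).csInf_mem hne hbdd
      exact eventually_measure_inter_le_exp hint hlim hΨ hc0 (hcF _ hmem.1)
        fun x hx => mul_le_mul_of_nonneg_left (csInf_le hbdd hx) hmem.2
  have hneg : ∀ᶠ n : ℕ in atTop, P.real {ω | ξ n ω ∈ F ∩ Iic 0} ≤ Real.exp (-(n * c)) := by
    rcases (F ∩ Iic 0).eq_empty_or_nonempty with he | hne
    · simp [he, Real.exp_nonneg]
    · have hbdd : BddAbove (F ∩ Iic 0) := ⟨0, fun x hx => hx.2⟩
      have hmem := (hF.inter isClosed_Iic).csSup_mem hne hbdd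
      exact eventually_measure_inter_le_exp hint hlim hΨ hc0 (hcF _ hmem.1)
        fun x hx => mul_le_mul_of_nonpos_left (le_csSup hbdd hx) hmem.2
  refine EReal.le_of_forall_lt_iff_le.1 fun a ha => ?_
  have ha : -c < a := by exact_mod_cast ha
  have h4 : ∀ᶠ n : ℕ in atTop, Real.log 2 < (n : ℝ) * (a + c) :=
    (tendsto_natCast_atTop_atTop.atTop_mul_const (by linarith)).eventually_gt_atTop _
  refine limsup_le_of_le (by isBoundedDefault) ?_
  filter_upwards [hpos, hneg, h4, eventually_gt_atTop 0] with n h1 h2 h3 hn0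
  rw [← inv_mul_log_ofReal_exp hn0 a]
  refine inv_mul_log_mono n ?_
  rw [← ofReal_measureReal]
  refine ENNReal.ofReal_le_ofReal ?_
  have hsub : {ω | ξ n ω ∈ F} ⊆ {ω | ξ n ω ∈ F ∩ Ici 0} ∪ {ω | ξ n ω ∈ F ∩ Iic 0} := by
    intro ω hω
    rcases le_total 0 (ξ n ω) with h | h
    · exact Or.inl ⟨hω, h⟩
    · exact Or.inr ⟨hω, h⟩
  calc P.real {ω | ξ n ω ∈ F} ≤ _ := measureReal_mono hsub
    _ ≤ _ := measureReal_union_le _ _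
    _ ≤ 2 * Real.exp (-(n * c)) := by linarith
    _ = Real.exp (Real.log 2 + -(n * c)) := by
      rw [Real.exp_add, Real.exp_log two_pos]
    _ ≤ Real.exp (n * a) := Real.exp_le_exp.2 (by linarith)

/-- The Gärtner–Ellis theorem for real random variables whose limiting scaled cumulant
generating function is finite, differentiable and nonnegative. -/
theorem isLDP_of_tendsto_cgf (hξ : ∀ n, Measurable (ξ n))
    (hint : ∀ n t, Integrable (fun ω => Real.exp (t * ξ n ω)) P)
    (hlim : ∀ t, Tendsto (fun n : ℕ => (n : ℝ)⁻¹ * cgf (ξ n) P (n * t)) atTop (𝓝 (Ψ t)))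
    (h0 : Ψ 0 = 0) (hΨ : ∀ t, 0 ≤ Ψ t) (hd : Differentiable ℝ Ψ) :
    IsLDP P ξ (fun n => (n : ℝ)) (legendre1 (fun t => (Ψ t : EReal))) := by
  refine ⟨lowerSemicontinuous_legendre1, fun Γ _ => ⟨?_, ?_⟩⟩
  · rw [EReal.neg_le]
    refine le_iInf₂ fun x hx => ?_
    rw [EReal.neg_le]
    exact gartnerEllis_lower hξ hint hlim h0 hd isOpen_interior hx
  · exact gartnerEllis_upper hint hlim hΨ isClosed_closure

end GartnerEllis

section FourthMoment

variable {Ω : Type*} [MeasurableSpace Ω] {μ : Measure Ω} [IsProbabilityMeasure μ]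

lemma integrable_pow_of_memLp_four {f : Ω → ℝ} (hf : MemLp f 4 μ) {k : ℕ} (hk : k ≤ 4) :
    Integrable (fun ω => f ω ^ k) μ := by
  have h1 : MemLp f k μ := hf.mono_exponent (by exact_mod_cast hk)
  have h2 := h1.integrable_norm_pow'
  refine h2.mono (hf.aestronglyMeasurable.pow k) (ae_of_all _ fun ω => ?_)
  simp

/-- Second and fourth moment bounds for sums of independent centered random variables. -/
lemma integral_sum_pow_le {ι : Type*} {Y : ι → Ω → ℝ} (hind : iIndepFun Y μ)
    (hm : ∀ i, Measurable (Y i)) (hY : ∀ i, MemLp (Y i) 4 μ) (h1 : ∀ i, ∫ ω, Y i ω ∂μ = 0)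
    {A : ℝ} (h2 : ∀ i, ∫ ω, Y i ω ^ 2 ∂μ ≤ A) (h4 : ∀ i, ∫ ω, Y i ω ^ 4 ∂μ ≤ A)
    (hA : 0 ≤ A) (s : Finset ι) :
    ∫ ω, (∑ i ∈ s, Y i ω) ^ 2 ∂μ ≤ s.card * A ∧
      ∫ ω, (∑ i ∈ s, Y i ω) ^ 4 ∂μ ≤ 3 * (A ^ 2 + A) * s.card ^ 2 := by
  classical
  induction s using Finset.induction_on with
  | empty => simp
  | insert a s ha ih =>
    obtain ⟨ih2, ih4⟩ := ih
    set S : Ω → ℝ := fun ω => ∑ i ∈ s, Y i ω with hS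
    have hSL : MemLp S 4 μ := memLp_finsetSum s fun i _ => hY i
    have hSY : IndepFun S (Y a) μ := by
      have := hind.indepFun_finsetSum_of_notMem hm ha
      convert this using 1
      ext ω
      simp [hS]
    have hprod : ∀ j k : ℕ, j ≤ 4 → k ≤ 4 →
        Integrable (fun ω => S ω ^ j * Y a ω ^ k) μ ∧
        ∫ ω, S ω ^ j * Y a ω ^ k ∂μ = (∫ ω, S ω ^ j ∂μ) * ∫ ω, Y a ω ^ k ∂μ := by
      intro j k hj hk
      have hi : IndepFun (fun ω => S ω ^ j) (fun ω => Y a ω ^ k) μ :=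
        hSY.comp (φ := fun x => x ^ j) (ψ := fun x => x ^ k) (by fun_prop) (by fun_prop)
      have e1 := integrable_pow_of_memLp_four hSL hj
      have e2 := integrable_pow_of_memLp_four (hY a) hk
      exact ⟨hi.integrable_mul e1 e2,
        hi.integral_mul_eq_mul_integral e1.aestronglyMeasurable e2.aestronglyMeasurable⟩
    have hSi : ∀ k : ℕ, k ≤ 4 → Integrable (fun ω => S ω ^ k) μ :=
      fun k hk => integrable_pow_of_memLp_four hSL hk
    have hYi : ∀ k : ℕ, k ≤ 4 → Integrable (fun ω => Y a ω ^ k) μ :=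
      fun k hk => integrable_pow_of_memLp_four (hY a) hk
    have hY0 : ∫ ω, Y a ω ^ 1 ∂μ = 0 := by simpa using h1 a
    have hS0 : ∫ ω, S ω ^ 1 ∂μ = 0 := by
      simp only [hS, pow_one]
      have hYint : ∀ i, Integrable (Y i) μ := fun i =>
        (hY i).integrable (by norm_num)
      rw [integral_finsetSum _ fun i _ => hYint i]
      simp [h1]
    have hins : ∀ ω, ∑ i ∈ insert a s, Y i ω = S ω + Y a ω := by
      intro ω; rw [Finset.sum_insert ha, add_comm]
    have c : (((insert a s).card : ℕ) : ℝ) = s.card + 1 := by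
      rw [Finset.card_insert_of_notMem ha]; push_cast; ring
    simp only [hins, c]
    have hS2 : 0 ≤ ∫ ω, S ω ^ 2 ∂μ := integral_nonneg fun ω => sq_nonneg _
    have hYY : 0 ≤ ∫ ω, Y a ω ^ 2 ∂μ := integral_nonneg fun ω => sq_nonneg _
    constructor
    · have e : ∫ ω, (S ω + Y a ω) ^ 2 ∂μ
          = ∫ ω, (S ω ^ 2 + 2 * (S ω ^ 1 * Y a ω ^ 1) + Y a ω ^ 2) ∂μ := by
        congr 1; ext ω; ring
      have i1 := (hprod 1 1 (by norm_num) (by norm_num)).1.const_mul 2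
      have i2 : Integrable (fun ω => S ω ^ 2 + 2 * (S ω ^ 1 * Y a ω ^ 1)) μ :=
        (hSi 2 (by norm_num)).add i1
      rw [e, integral_add i2 (hYi 2 (by norm_num)),
        integral_add (hSi 2 (by norm_num)) i1, integral_const_mul,
        (hprod 1 1 (by norm_num) (by norm_num)).2, hY0]
      nlinarith [h2 a]
    · have e : ∫ ω, (S ω + Y a ω) ^ 4 ∂μ
          = ∫ ω, (S ω ^ 4 + 4 * (S ω ^ 3 * Y a ω ^ 1) + 6 * (S ω ^ 2 * Y a ω ^ 2)
            + 4 * (S ω ^ 1 * Y a ω ^ 3) + Y a ω ^ 4) ∂μ := by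
        congr 1; ext ω; ring
      have j0 := hSi 4 le_rfl
      have j1 := (hprod 3 1 (by norm_num) (by norm_num)).1.const_mul 4
      have j2 := (hprod 2 2 (by norm_num) (by norm_num)).1.const_mul 6
      have j3 := (hprod 1 3 (by norm_num) (by norm_num)).1.const_mul 4
      have k1 : Integrable (fun ω => S ω ^ 4 + 4 * (S ω ^ 3 * Y a ω ^ 1)) μ := j0.add j1
      have k2 : Integrable (fun ω => S ω ^ 4 + 4 * (S ω ^ 3 * Y a ω ^ 1)
        + 6 * (S ω ^ 2 * Y a ω ^ 2)) μ := k1.add j2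
      have k3 : Integrable (fun ω => S ω ^ 4 + 4 * (S ω ^ 3 * Y a ω ^ 1)
        + 6 * (S ω ^ 2 * Y a ω ^ 2) + 4 * (S ω ^ 1 * Y a ω ^ 3)) μ := k2.add j3
      rw [e, integral_add k3 (hYi 4 le_rfl), integral_add k2 j3, integral_add k1 j2,
        integral_add j0 j1, integral_const_mul, integral_const_mul, integral_const_mul,
        (hprod 3 1 (by norm_num) (by norm_num)).2, (hprod 2 2 (by norm_num) (by norm_num)).2,
        (hprod 1 3 (by norm_num) (by norm_num)).2, hY0, hS0]
      have := mul_le_mul ih2 (h2 a) hYY (by positivity)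
      nlinarith [h4 a]

/-- Strong law of large numbers for triangular arrays with i.i.d. rows and arbitrary
dependence between the rows, under a fourth moment assumption. -/
lemma ae_tendsto_average {Z : (n : ℕ) → Ω → Fin n → ℝ} (hZ : ∀ n, Measurable (Z n))
    {ν : Measure ℝ} [IsProbabilityMeasure ν]
    (hlaw : ∀ n, 0 < n → μ.map (Z n) = Measure.pi fun _ => ν)
    {f : ℝ → ℝ} (hf : Measurable f) (hf4 : MemLp f 4 ν) :
    ∀ᵐ ω ∂μ, Tendsto (fun n : ℕ => (n : ℝ)⁻¹ * ∑ i, f (Z n ω i)) atTop (𝓝 (∫ u, f u ∂ν)) := by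
  set m := ∫ u, f u ∂ν with hm
  set g : ℝ → ℝ := fun u => f u - m with hg
  have hgm : Measurable g := hf.sub_const m
  have hg4 : MemLp g 4 ν := hf4.sub (memLp_const m)
  have hfi : Integrable f ν := by
    simpa using integrable_pow_of_memLp_four hf4 (k := 1) (by norm_num)
  have hg0 : ∫ u, g u ∂ν = 0 := by
    simp only [hg]
    rw [integral_sub hfi (integrable_const _)]
    simp [hm]
  obtain ⟨A, hA0, hA2, hA4⟩ : ∃ A : ℝ, 0 ≤ A ∧ ∫ u, g u ^ 2 ∂ν ≤ A ∧ ∫ u, g u ^ 4 ∂ν ≤ A := by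
    have : 0 ≤ ∫ u, g u ^ 2 ∂ν := integral_nonneg fun u => sq_nonneg _
    exact ⟨_, le_max_of_le_left this, le_max_left _ (∫ u, g u ^ 4 ∂ν), le_max_right _ _⟩
  set D : ℕ → Ω → ℝ := fun n ω => (n : ℝ)⁻¹ * ∑ i, g (Z n ω i) with hD
  have hDm : ∀ n, Measurable (D n) := fun n => by fun_prop
  set K := 3 * (A ^ 2 + A) with hK
  have hbound : ∀ n, ∫⁻ ω, ENNReal.ofReal (D n ω ^ 4) ∂μ
      ≤ ENNReal.ofReal (K * (1 / (n : ℝ) ^ 2)) := by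
    intro n
    rcases Nat.eq_zero_or_pos n with rfl | hn
    · simp [hD]
    have hn' : (0 : ℝ) < n := by exact_mod_cast hn
    have e1 : ∫⁻ ω, ENNReal.ofReal (D n ω ^ 4) ∂μ
        = ∫⁻ x, ENNReal.ofReal (((n : ℝ)⁻¹ * ∑ i, g (x i)) ^ 4)
          ∂(Measure.pi fun _ : Fin n => ν) := by
      rw [← hlaw n hn, lintegral_map (by fun_prop) (hZ n)]
    have hind : iIndepFun (fun (i : Fin n) (x : Fin n → ℝ) => g (x i))
        (Measure.pi fun _ : Fin n => ν) :=
      iIndepFun_pi fun i => hgm.aemeasurable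
    have hmp : ∀ i : Fin n, MeasurePreserving (Function.eval i)
        (Measure.pi fun _ : Fin n => ν) ν := fun i => measurePreserving_eval _ i
    have hL : ∀ i : Fin n, MemLp (fun x : Fin n → ℝ => g (x i)) 4 (Measure.pi fun _ => ν) :=
      fun i => hg4.comp_measurePreserving (hmp i)
    have hint : ∀ (i : Fin n) (k : ℕ), ∫ x : Fin n → ℝ, g (x i) ^ k ∂(Measure.pi fun _ => ν)
        = ∫ u, g u ^ k ∂ν := by
      intro i k
      rw [← (hmp i).map_eq, integral_map (hmp i).aemeasurable
        (hgm.pow_const k).aestronglyMeasurable]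
      simp [(hmp i).map_eq]
    have hfour := (integral_sum_pow_le hind (fun i => by fun_prop) hL
      (fun i => by simpa [hg0] using hint i 1) (fun i => (hint i 2).trans_le hA2)
      (fun i => (hint i 4).trans_le hA4) hA0 Finset.univ).2
    have hSL : MemLp (fun x : Fin n → ℝ => ∑ i, g (x i)) 4 (Measure.pi fun _ => ν) :=
      memLp_finsetSum _ fun i _ => hL i
    rw [e1, ← ofReal_integral_eq_lintegral_ofReal]
    · refine ENNReal.ofReal_le_ofReal ?_
      simp only [mul_pow]
      rw [integral_const_mul]
      simp only [Finset.card_univ, Fintype.card_fin] at hfour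
      refine (mul_le_mul_of_nonneg_left hfour (by positivity)).trans_eq ?_
      rw [hK]
      field_simp
    · simp only [mul_pow]
      exact (integrable_pow_of_memLp_four hSL le_rfl).const_mul _
    · exact ae_of_all _ fun x => by positivity
  have hsum : ∫⁻ ω, ∑' n, ENNReal.ofReal (D n ω ^ 4) ∂μ ≠ ∞ := by
    rw [lintegral_tsum fun n => by fun_prop]
    refine ne_top_of_le_ne_top ?_ (ENNReal.tsum_le_tsum hbound)
    exact (Summable.mul_left K (Real.summable_one_div_nat_pow.2 one_lt_two)).tsum_ofReal_ne_top
  filter_upwards [ae_lt_top (by fun_prop) hsum] with ω hω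
  have h1 := ENNReal.tendsto_atTop_zero_of_tsum_ne_top hω.ne
  have h2 : Tendsto (fun n => D n ω ^ 4) atTop (𝓝 0) := by
    have := (ENNReal.tendsto_toReal ENNReal.zero_ne_top).comp h1
    refine this.congr fun n => ?_
    simp only [Function.comp]
    exact ENNReal.toReal_ofReal (by positivity)
  have h3 : Tendsto (fun n => D n ω) atTop (𝓝 0) := by
    rw [tendsto_zero_iff_abs_tendsto_zero]
    have h4 := (h2.sqrt).sqrt
    simp only [Real.sqrt_zero] at h4
    refine h4.congr fun n => ?_
    rw [show D n ω ^ 4 = (D n ω ^ 2) ^ 2 by ring, Real.sqrt_sq (sq_nonneg _), Real.sqrt_sq_eq_abs]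
    rfl
  have h5 := h3.add_const m
  rw [zero_add] at h5
  refine h5.congr' ?_
  filter_upwards [eventually_gt_atTop 0] with n hn
  have hn' : (n : ℝ) ≠ 0 := by positivity
  simp only [hD, hg, Finset.sum_sub_distrib, Finset.sum_const, Finset.card_univ,
    Fintype.card_fin, nsmul_eq_mul]
  field_simp
  ring

end FourthMoment

section Sphere

open Matrix

lemma unitSphere_sum_sq_nonneg {n : ℕ} (x : Fin n → ℝ) : 0 ≤ ∑ i, x i ^ 2 :=
  Finset.sum_nonneg fun _ _ => sq_nonneg _

/-- The orthogonal group acts transitively on spheres. -/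
lemma exists_orthogonal_mulVec_eq {n : ℕ} {a b : Fin n → ℝ}
    (h : ∑ i, a i ^ 2 = ∑ i, b i ^ 2) :
    ∃ O : Matrix.orthogonalGroup (Fin n) ℝ, (O : Matrix (Fin n) (Fin n) ℝ) *ᵥ a = b := by
  have h : a ⬝ᵥ a = b ⬝ᵥ b := by simpa [dotProduct, sq] using h
  set v := a - b with hv
  rcases eq_or_ne v 0 with h0 | h0
  · exact ⟨1, by simpa using sub_eq_zero.1 (hv ▸ h0)⟩
  have hvv : v ⬝ᵥ v ≠ 0 := fun hh => h0 (dotProduct_self_eq_zero.1 hh)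
  set H : Matrix (Fin n) (Fin n) ℝ := 1 - (2 / (v ⬝ᵥ v)) • vecMulVec v v with hH
  have hsymm : Hᵀ = H := by
    simp [hH, transpose_vecMulVec]
  have hsq : H * H = 1 := by
    have e : vecMulVec v v * vecMulVec v v = (v ⬝ᵥ v) • vecMulVec v v := by
      rw [vecMulVec_mul_vecMulVec]
      ext i j
      simp [vecMulVec_apply]
      ring
    have e2 : (2 / (v ⬝ᵥ v)) * (2 / (v ⬝ᵥ v)) * (v ⬝ᵥ v) = 2 * (2 / (v ⬝ᵥ v)) := by
      field_simp
    rw [hH, sub_mul, one_mul, mul_sub, mul_one, smul_mul_assoc, mul_smul_comm, e, smul_smul,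
      smul_smul, e2, two_mul, add_smul]
    abel
  refine ⟨⟨H, (mem_orthogonalGroup_iff _ _).2 ?_⟩, ?_⟩
  · rw [hsymm, hsq]
  · have hva : v ⬝ᵥ v = 2 * (v ⬝ᵥ a) := by
      simp only [hv, sub_dotProduct, dotProduct_sub]
      rw [dotProduct_comm a b]
      linarith
    have e3 : 2 / (v ⬝ᵥ v) * (v ⬝ᵥ a) = 1 := by
      rw [hva] at hvv ⊢
      have : v ⬝ᵥ a ≠ 0 := fun hh => hvv (by rw [hh, mul_zero])
      field_simp
    have e4 : vecMulVec v v *ᵥ a = (v ⬝ᵥ a) • v := by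
      ext i
      simp [vecMulVec_mulVec]
      ring
    change H *ᵥ a = b
    rw [hH, sub_mulVec, one_mulVec, smul_mulVec, e4, smul_smul, e3, one_smul, hv, sub_sub_cancel]

/-- The characteristic function of a rotation-invariant measure is radial. -/
lemma LDP.IsUniformSphere.integral_exp_congr {n : ℕ} {μ : Measure (Fin n → ℝ)}
    (hμ : IsUniformSphere μ) {a b : Fin n → ℝ} (h : ∑ i, a i ^ 2 = ∑ i, b i ^ 2) :
    ∫ x, Complex.exp ((∑ i, a i * x i : ℝ) * Complex.I) ∂μ
      = ∫ x, Complex.exp ((∑ i, b i * x i : ℝ) * Complex.I) ∂μ := by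
  obtain ⟨O, hO⟩ := exists_orthogonal_mulVec_eq h
  have hm : Measurable fun x : Fin n → ℝ => (O : Matrix (Fin n) (Fin n) ℝ) *ᵥ x :=
    (Continuous.matrix_mulVec continuous_const continuous_id).measurable
  conv_rhs => rw [← hμ.2.2 O]
  rw [integral_map hm.aemeasurable (Measurable.aestronglyMeasurable (by fun_prop))]
  congr 1
  ext x
  congr 3
  have e : ∀ y z : Fin n → ℝ, ∑ i, y i * z i = y ⬝ᵥ z := fun y z => rfl
  rw [e, e, ← hO, dotProduct_mulVec, vecMul_mulVec]
  have : (O : Matrix (Fin n) (Fin n) ℝ)ᵀ * (O : Matrix (Fin n) (Fin n) ℝ) = 1 :=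
    (mem_orthogonalGroup_iff' _ _).1 O.2
  rw [this, vecMul_one]

lemma integral_exp_pi_gaussian {n : ℕ} (a : Fin n → ℝ) :
    ∫ y, Complex.exp ((∑ i, a i * y i : ℝ) * Complex.I)
      ∂(Measure.pi fun _ : Fin n => gaussianReal 0 1)
      = Complex.exp (-(∑ i, a i ^ 2 : ℝ) / 2) := by
  have e : ∀ y : Fin n → ℝ, Complex.exp ((∑ i, a i * y i : ℝ) * Complex.I)
      = ∏ i, Complex.exp (a i * y i * Complex.I) := by
    intro y
    rw [← Complex.exp_sum]
    push_cast
    rw [Finset.sum_mul]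
  simp_rw [e]
  rw [integral_fintype_prod_eq_prod (fun i (u : ℝ) => Complex.exp (a i * u * Complex.I))]
  simp_rw [← charFun_apply_real, charFun_gaussianReal]
  rw [← Complex.exp_sum]
  congr 1
  push_cast
  rw [neg_div, Finset.sum_div, ← Finset.sum_neg_distrib]
  refine Finset.sum_congr rfl fun i _ => ?_
  simp

/-- A uniform point of the sphere scaled by the norm of an independent standard Gaussian
vector is a standard Gaussian vector. -/
lemma LDP.IsUniformSphere.map_prod_smul {n : ℕ} {μ : Measure (Fin n → ℝ)} (hμ : IsUniformSphere μ) :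
    (μ.prod (Measure.pi fun _ : Fin n => gaussianReal 0 1)).map
      (fun p => Real.sqrt (∑ i, p.2 i ^ 2) • p.1) = Measure.pi fun _ => gaussianReal 0 1 := by
  have := hμ.1
  set g : Measure (Fin n → ℝ) := Measure.pi fun _ => gaussianReal 0 1 with hg
  have hm : Measurable fun p : (Fin n → ℝ) × (Fin n → ℝ) =>
    Real.sqrt (∑ i, p.2 i ^ 2) • p.1 := by fun_prop
  have : IsProbabilityMeasure ((μ.prod g).map
    (fun p => Real.sqrt (∑ i, p.2 i ^ 2) • p.1)) := Measure.isProbabilityMeasure_map hm.aemeasurable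
  refine Measure.ext_of_charFunDual (funext fun L => ?_)
  obtain ⟨a, ha⟩ : ∃ a : Fin n → ℝ, ∀ x, L x = ∑ i, a i * x i := by
    refine ⟨fun i => L (Pi.single i 1), fun x => ?_⟩
    conv_lhs => rw [pi_eq_sum_univ' x, map_sum]
    refine Finset.sum_congr rfl fun i _ => ?_
    rw [map_smul, smul_eq_mul, mul_comm]
  have hbound : ∀ r : ℝ, ‖Complex.exp (r * Complex.I)‖ ≤ 1 :=
    fun r => (Complex.norm_exp_ofReal_mul_I r).le
  have hsw : ∀ F : (Fin n → ℝ) × (Fin n → ℝ) → ℝ, Measurable F →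
      ∀ (ν₁ ν₂ : Measure (Fin n → ℝ)) [IsProbabilityMeasure ν₁] [IsProbabilityMeasure ν₂],
      Integrable (fun p => Complex.exp (F p * Complex.I)) (ν₁.prod ν₂) := by
    intro F hF ν₁ ν₂ _ _
    exact Integrable.of_bound (Measurable.aestronglyMeasurable (by fun_prop)) 1 (ae_of_all _ fun p => hbound _)
  set ρ := Real.sqrt (∑ i, a i ^ 2) with hρ
  have hρ2 : ρ ^ 2 = ∑ i, a i ^ 2 := Real.sq_sqrt (unitSphere_sum_sq_nonneg a)
  have hsph : ∀ᵐ x ∂μ, ∑ i, x i ^ 2 = 1 := by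
    have hms : MeasurableSet (unitSphereSet n) :=
      measurableSet_eq_fun (by fun_prop) measurable_const
    exact (prob_compl_eq_zero_iff hms).2 hμ.2.1
  rw [charFunDual_apply, charFunDual_apply, integral_map hm.aemeasurable (Measurable.aestronglyMeasurable (by fun_prop))]
  simp only [ha]
  rw [integral_exp_pi_gaussian, integral_prod_symm _ (hsw _ (by fun_prop) _ _)]
  have step : ∀ y : Fin n → ℝ,
      ∫ x, Complex.exp ((∑ i, a i * (Real.sqrt (∑ i, y i ^ 2) • x) i : ℝ) * Complex.I) ∂μ
      = ∫ x, Complex.exp ((∑ i, (ρ * y i) * x i : ℝ) * Complex.I) ∂μ := by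
    intro y
    have := hμ.integral_exp_congr (a := fun i => Real.sqrt (∑ i, y i ^ 2) * a i)
      (b := fun i => ρ * y i) (by
        simp only [mul_pow, ← Finset.mul_sum]
        rw [hρ2, Real.sq_sqrt (unitSphere_sum_sq_nonneg y), mul_comm])
    rw [← this]
    congr 1
    ext x
    congr 3
    refine Finset.sum_congr rfl fun i _ => ?_
    simp only [Pi.smul_apply, smul_eq_mul]
    ring
  simp only [step]
  rw [integral_integral_swap (hsw (fun p => ∑ i, (ρ * p.1 i) * p.2 i) (by fun_prop) g μ)]
  have step2 : ∀ᵐ x ∂μ, ∫ y, Complex.exp ((∑ i, (ρ * y i) * x i : ℝ) * Complex.I) ∂g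
      = Complex.exp (-(∑ i, a i ^ 2 : ℝ) / 2) := by
    filter_upwards [hsph] with x hx
    have := integral_exp_pi_gaussian (fun i => ρ * x i)
    simp only [mul_pow, ← Finset.mul_sum] at this
    rw [hx, mul_one, hρ2] at this
    rw [← this]
    congr 1
    ext y
    congr 3
    refine Finset.sum_congr rfl fun i _ => ?_
    ring
  rw [integral_congr_ae step2]
  simp

end Sphere

section LogMGF

/-- A convex differentiable function lies above its tangents. -/
lemma add_deriv_mul_le_of_convexOn {f : ℝ → ℝ} (hf : ConvexOn ℝ univ f)
    (hd : Differentiable ℝ f) (x y : ℝ) : f x + deriv f x * (y - x) ≤ f y := by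
  rcases lt_trichotomy x y with h | rfl | h
  · have := hf.le_slope_of_hasDerivAt (mem_univ x) (mem_univ y) h (hd x).hasDerivAt
    rw [slope_def_field, le_div_iff₀ (by linarith)] at this
    linarith
  · simp
  · have := hf.slope_le_of_hasDerivAt (mem_univ y) (mem_univ x) h (hd x).hasDerivAt
    rw [slope_def_field, div_le_iff₀ (by linarith)] at this
    linarith

lemma exists_rpow_abs_le_exp (p : ℝ) (hp : 0 ≤ p) :
    ∃ K : ℝ, 0 ≤ K ∧ ∀ s : ℝ, |s| ^ p ≤ K * Real.exp |s| := by
  set N := ⌈p⌉₊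
  refine ⟨1 + N.factorial, by positivity, fun s => ?_⟩
  have h1 : (1 : ℝ) ≤ Real.exp |s| := Real.one_le_exp (abs_nonneg s)
  rcases le_total |s| 1 with h | h
  · have := Real.rpow_le_one (abs_nonneg s) h hp
    have : 0 ≤ (N.factorial : ℝ) * Real.exp |s| := by positivity
    linarith
  · have h2 : |s| ^ p ≤ |s| ^ (N : ℝ) := Real.rpow_le_rpow_of_exponent_le h (Nat.le_ceil p)
    rw [Real.rpow_natCast] at h2
    have h3 := Real.pow_div_factorial_le_exp |s| (abs_nonneg s) N
    rw [div_le_iff₀ (by positivity)] at h3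
    nlinarith

variable {γ : Measure ℝ} {q : ℝ}

lemma integrable_exp_mul_of_memT (hγ : memT q γ) (t : ℝ) :
    Integrable (fun y => Real.exp (t * y)) γ := by
  obtain ⟨C, hC⟩ := hγ
  have h1 : logM γ t < ⊤ := (hC t).trans_lt (EReal.coe_lt_top _)
  rw [logM, ENNReal.log_lt_top_iff] at h1
  refine ⟨by fun_prop, ?_⟩
  rwa [hasFiniteIntegral_iff_ofReal (ae_of_all _ fun y => (Real.exp_pos _).le)]

lemma interior_integrableExpSet_of_memT (hγ : memT q γ) (t : ℝ) :
    t ∈ interior (integrableExpSet id γ) := by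
  have : integrableExpSet id γ = univ := eq_univ_of_forall fun s => integrable_exp_mul_of_memT hγ s
  simp [this]

lemma differentiable_cgf_of_memT (hγ : memT q γ) : Differentiable ℝ (cgf id γ) :=
  fun t => (analyticAt_cgf (interior_integrableExpSet_of_memT hγ t)).differentiableAt

lemma convexOn_cgf_of_memT (hγ : memT q γ) : ConvexOn ℝ univ (cgf id γ) := by
  refine convexOn_univ_of_deriv2_nonneg (differentiable_cgf_of_memT hγ)
    (fun t => (analyticAt_cgf (interior_integrableExpSet_of_memT hγ t)).deriv.differentiableAt)
    fun t => ?_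
  rw [← iteratedDeriv_eq_iterate,
    iteratedDeriv_two_cgf_eq_integral (interior_integrableExpSet_of_memT hγ t)]
  exact div_nonneg (integral_nonneg fun y => by positivity) mgf_nonneg

variable [IsProbabilityMeasure γ]

lemma logM_eq_cgf (hγ : memT q γ) (t : ℝ) : logM γ t = (cgf id γ t : ℝ) := by
  have hi := integrable_exp_mul_of_memT hγ t
  have hpos : 0 < ∫ y, Real.exp (t * y) ∂γ := mgf_pos (X := id) hi
  rw [logM, ← ofReal_integral_eq_lintegral_ofReal hi (ae_of_all _ fun y => (Real.exp_pos _).le),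
    ENNReal.log_ofReal_of_pos hpos]
  rfl

/-- The log moment generating function and its derivative grow at most exponentially. -/
lemma exists_cgf_bound_of_memT (hq : 1 < q) (hγ : memT q γ) :
    ∃ K : ℝ, (∀ s, |cgf id γ s| ≤ K * Real.exp |s|) ∧
      ∀ s, |deriv (cgf id γ) s| ≤ K * Real.exp |s| := by
  have htan := add_deriv_mul_le_of_convexOn (convexOn_cgf_of_memT hγ) (differentiable_cgf_of_memT hγ)
  set Λ := cgf id γ with hΛ
  have h0 : Λ 0 = 0 := cgf_zero
  obtain ⟨K₀, hK₀, hK⟩ := exists_rpow_abs_le_exp (q / (q - 1)) (by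
    have : 0 < q - 1 := by linarith
    positivity)
  have hexp : ∀ s : ℝ, 1 ≤ Real.exp |s| := fun s => Real.one_le_exp (abs_nonneg s)
  have habs : ∀ s : ℝ, |s| ≤ Real.exp |s| := fun s => by linarith [Real.add_one_le_exp |s|]
  obtain ⟨A, hA0, hA⟩ : ∃ A : ℝ, 0 ≤ A ∧ ∀ s, |Λ s| ≤ A * Real.exp |s| := by
    have hγ' := hγ
    obtain ⟨C, hC⟩ := hγ'
    refine ⟨|C| * (K₀ + 1) + |deriv Λ 0|, by positivity, fun s => abs_le.2 ⟨?_, ?_⟩⟩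
    · have h1 := htan 0 s
      have h2 : -(|deriv Λ 0| * |s|) ≤ deriv Λ 0 * s := by
        rw [← abs_mul]; exact neg_abs_le _
      have h3 := mul_le_mul_of_nonneg_left (habs s) (abs_nonneg (deriv Λ 0))
      have h4 : 0 ≤ |C| * (K₀ + 1) * Real.exp |s| := by positivity
      rw [h0, sub_zero, zero_add] at h1
      linarith
    · have h1 := hC s
      rw [logM_eq_cgf hγ, EReal.coe_le_coe_iff] at h1
      have h2 : C * |s| ^ (q / (q - 1)) ≤ |C| * (K₀ * Real.exp |s|) :=
        mul_le_mul (le_abs_self C) (hK s) (by positivity) (abs_nonneg C)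
      have h3 : C ≤ |C| * Real.exp |s| := by nlinarith [le_abs_self C, hexp s, abs_nonneg C]
      have h4 : 0 ≤ |deriv Λ 0| * Real.exp |s| := by positivity
      linarith
  have he1 : 1 ≤ Real.exp 1 := Real.one_le_exp zero_le_one
  refine ⟨A * (Real.exp 1 + 1), fun s => (hA s).trans ?_, fun s => abs_le.2 ⟨?_, ?_⟩⟩
  · have : 0 ≤ A * Real.exp |s| := by positivity
    nlinarith
  all_goals
    have hstep : ∀ d : ℝ, |d| ≤ 1 → |Λ (s + d)| ≤ A * (Real.exp 1 * Real.exp |s|) := by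
      intro d hd
      refine (hA _).trans (mul_le_mul_of_nonneg_left ?_ hA0)
      rw [← Real.exp_add]
      refine Real.exp_le_exp.2 ?_
      linarith [abs_add_le s d]
  · have h1 := htan s (s + -1)
    have h2 := (abs_le.1 (hstep (-1) (by simp))).2
    have h3 := (abs_le.1 (hA s)).1
    linarith
  · have h1 := htan s (s + 1)
    have h2 := (abs_le.1 (hstep 1 (by simp))).2
    have h3 := (abs_le.1 (hA s)).1
    linarith

end LogMGF

section GaussianAverage

lemma muP_two : muP 2 = gaussianReal 0 1 := by
  have hG : Real.Gamma (1 + 1 / 2) = Real.sqrt Real.pi / 2 := by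
    rw [add_comm, Real.Gamma_add_one (by norm_num), Real.Gamma_one_half_eq]
    ring
  rw [muP, gaussianReal_of_var_ne_zero 0 one_ne_zero, gaussianPDF_def]
  congr 1
  ext y
  rw [gaussianPDFReal, hG, ← Real.sqrt_eq_rpow]
  have h1 : |y| ^ (2 : ℝ) = y ^ 2 := by
    rw [show (2 : ℝ) = (2 : ℕ) by norm_num, Real.rpow_natCast, sq_abs]
  rw [h1]
  congr 2
  · simp only [NNReal.coe_one, mul_one]
    rw [Real.sqrt_mul (by norm_num)]
    congr 1
    ring
  · simp

lemma integrable_exp_mul_abs_gaussian (t : ℝ) :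
    Integrable (fun u : ℝ => Real.exp (t * |u|)) (gaussianReal 0 1) :=
  integrable_exp_mul_abs (X := id) (integrable_exp_mul_gaussianReal t)
    (integrable_exp_mul_gaussianReal (-t))

lemma memLp_exp_mul_abs_gaussian (t : ℝ) :
    MemLp (fun u : ℝ => Real.exp (t * |u|)) 4 (gaussianReal 0 1) := by
  refine (integrable_norm_rpow_iff (by fun_prop) (by norm_num) (by norm_num)).1 ?_
  refine (integrable_exp_mul_abs_gaussian (4 * t)).congr (ae_of_all _ fun u => ?_)
  simp only [Real.norm_eq_abs, Real.abs_exp]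
  rw [show (4 : ℝ≥0∞).toReal = (4 : ℕ) by norm_num, Real.rpow_natCast, ← Real.exp_nat_mul]
  congr 1
  push_cast
  ring

lemma eIntegral_coe {ν : Measure ℝ} {f : ℝ → ℝ} (hf : Integrable f ν) :
    eIntegral ν (fun u => (f u : EReal)) = (∫ u, f u ∂ν : ℝ) := by
  have h1 : ∀ x : ℝ, erealToENNReal (x : EReal) = ENNReal.ofReal x := fun x => by
    simp [erealToENNReal]
  have h2 : ∀ x : ℝ, erealToENNReal (-(x : EReal)) = ENNReal.ofReal (-x) := fun x => by
    rw [← EReal.coe_neg, h1]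
  have hfin : ∀ g : ℝ → ℝ, Integrable g ν → ∫⁻ u, ENNReal.ofReal (g u) ∂ν ≠ ∞ :=
    fun g hg => hg.lintegral_lt_top.ne
  simp only [eIntegral, h1, h2]
  rw [integral_eq_lintegral_pos_part_sub_lintegral_neg_part hf, EReal.coe_sub,
    EReal.coe_ennreal_toReal (hfin _ hf), EReal.coe_ennreal_toReal (hfin (fun u => -f u) hf.neg)]

variable {Λ : ℝ → ℝ} {K : ℝ}

lemma abs_sub_le_of_deriv_bound (hd : Differentiable ℝ Λ)
    (hK' : ∀ s, |deriv Λ s| ≤ K * Real.exp |s|) {T s r : ℝ} (hs : |s| ≤ T) (hr : |r| ≤ T) (u : ℝ) :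
    |Λ (s * u) - Λ (r * u)| ≤ K * |s - r| * Real.exp ((T + 1) * |u|) := by
  have hK0 : 0 ≤ K := by
    have := (abs_nonneg _).trans (hK' 0)
    simpa using this
  have hmem : ∀ {s : ℝ}, |s| ≤ T → s * u ∈ Metric.closedBall (0 : ℝ) (T * |u|) := by
    intro s hs
    rw [mem_closedBall_zero_iff, Real.norm_eq_abs, abs_mul]
    exact mul_le_mul_of_nonneg_right hs (abs_nonneg u)
  have h1 := (convex_closedBall (0 : ℝ) (T * |u|)).norm_image_sub_le_of_norm_deriv_le
    (f := Λ) (C := K * Real.exp (T * |u|)) (fun x _ => hd x) (fun x hx => by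
      rw [mem_closedBall_zero_iff, Real.norm_eq_abs] at hx
      exact (hK' x).trans (mul_le_mul_of_nonneg_left (Real.exp_le_exp.2 hx) hK0)) (hmem hr) (hmem hs)
  rw [Real.norm_eq_abs, Real.norm_eq_abs, ← sub_mul, abs_mul] at h1
  refine h1.trans ?_
  rw [add_mul, one_mul, Real.exp_add]
  have h2 : |u| ≤ Real.exp |u| := by linarith [Real.add_one_le_exp |u|]
  have h3 : 0 ≤ K * |s - r| * Real.exp (T * |u|) := by positivity
  have := mul_le_mul_of_nonneg_left h2 h3
  linarith

lemma memLp_comp_mul_gaussian (hd : Differentiable ℝ Λ)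
    (hK : ∀ s, |Λ s| ≤ K * Real.exp |s|) (t : ℝ) : MemLp (fun u => Λ (t * u)) 4 (gaussianReal 0 1) := by
  refine ((memLp_exp_mul_abs_gaussian |t|).const_mul K).mono
    (hd.continuous.comp (by fun_prop)).aestronglyMeasurable (ae_of_all _ fun u => ?_)
  have := hK (t * u)
  rw [abs_mul] at this
  exact this.trans (le_abs_self _)

lemma integrable_comp_mul_gaussian (hd : Differentiable ℝ Λ)
    (hK : ∀ s, |Λ s| ≤ K * Real.exp |s|) (t : ℝ) :
    Integrable (fun u => Λ (t * u)) (gaussianReal 0 1) :=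
  (memLp_comp_mul_gaussian hd hK t).integrable (by norm_num)

lemma differentiable_integral_comp_mul_gaussian (hd : Differentiable ℝ Λ)
    (hK : ∀ s, |Λ s| ≤ K * Real.exp |s|) (hK' : ∀ s, |deriv Λ s| ≤ K * Real.exp |s|) :
    Differentiable ℝ fun t => ∫ u, Λ (t * u) ∂(gaussianReal 0 1) := by
  intro t
  have hK0 : 0 ≤ K := by
    have := (abs_nonneg _).trans (hK' 0)
    simpa using this
  refine (hasDerivAt_integral_of_dominated_loc_of_deriv_le (F' := fun s u => deriv Λ (s * u) * u)
    (bound := fun u => K * Real.exp ((|t| + 2) * |u|)) (Metric.ball_mem_nhds t one_pos)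
    (Eventually.of_forall fun s => (hd.continuous.comp (by fun_prop)).aestronglyMeasurable)
    (integrable_comp_mul_gaussian hd hK t) ?_ ?_ ?_ ?_).2.differentiableAt
  · have : Measurable (deriv Λ) := measurable_deriv Λ
    exact Measurable.aestronglyMeasurable (by fun_prop)
  · refine ae_of_all _ fun u s hs => ?_
    have hs' : |s| ≤ |t| + 1 := by
      rw [Metric.mem_ball, Real.dist_eq] at hs
      have := abs_add_le (s - t) t
      rw [sub_add_cancel] at this
      linarith
    rw [norm_mul, Real.norm_eq_abs, Real.norm_eq_abs]
    have h1 : |deriv Λ (s * u)| ≤ K * Real.exp ((|t| + 1) * |u|) := by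
      refine (hK' _).trans (mul_le_mul_of_nonneg_left (Real.exp_le_exp.2 ?_) hK0)
      rw [abs_mul]
      exact mul_le_mul_of_nonneg_right hs' (abs_nonneg u)
    have h2 : |u| ≤ Real.exp |u| := by linarith [Real.add_one_le_exp |u|]
    refine (mul_le_mul h1 h2 (abs_nonneg u) (by positivity)).trans_eq ?_
    rw [mul_assoc, ← Real.exp_add]
    ring_nf
  · exact (integrable_exp_mul_abs_gaussian _).const_mul K
  · refine ae_of_all _ fun u s _ => ?_
    have := (hd (s * u)).hasDerivAt.comp s ((hasDerivAt_id s).mul_const u)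
    simpa [Function.comp_def] using this

end GaussianAverage

section SphereAverage

/-- Averages of a smooth function over the rescaled coordinates of a unit vector converge, as soon
as they converge for a Gaussian vector with the same direction. -/
lemma tendsto_average_of_gaussian {Λ : ℝ → ℝ} {K : ℝ} (hd : Differentiable ℝ Λ)
    (hK' : ∀ s, |deriv Λ s| ≤ K * Real.exp |s|) {Ψ : ℝ → ℝ} (hΨ : Continuous Ψ)
    {θ z : (n : ℕ) → Fin n → ℝ} {ρ : ℕ → ℝ} (hρ : ∀ n, 0 ≤ ρ n)
    (hz : ∀ n i, z n i = ρ n * θ n i) (hθ : ∀ n, 0 < n → ∑ i, θ n i ^ 2 = 1)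
    (h2 : Tendsto (fun n : ℕ => (n : ℝ)⁻¹ * ∑ i, z n i ^ 2) atTop (𝓝 1))
    (hr : ∀ r : ℚ, Tendsto (fun n : ℕ => (n : ℝ)⁻¹ * ∑ i, Λ (r * z n i)) atTop (𝓝 (Ψ r)))
    (hT : ∀ T : ℕ, ∃ M : ℝ, Tendsto (fun n : ℕ => (n : ℝ)⁻¹ * ∑ i, Real.exp (T * |z n i|)) atTop
      (𝓝 M)) (t : ℝ) :
    Tendsto (fun n : ℕ => (n : ℝ)⁻¹ * ∑ i, Λ (t * (Real.sqrt n * θ n i))) atTop (𝓝 (Ψ t)) := by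
  have hK0 : 0 ≤ K := by
    have := (abs_nonneg _).trans (hK' 0)
    simpa using this
  have hz2 : ∀ n, 0 < n → ∑ i, z n i ^ 2 = ρ n ^ 2 := fun n hn => by
    simp only [hz, mul_pow]
    rw [← Finset.mul_sum, hθ n hn, mul_one]
  set c : ℕ → ℝ := fun n => Real.sqrt n / ρ n with hc
  have hc1 : Tendsto c atTop (𝓝 1) := by
    have h3 : Tendsto (fun n : ℕ => Real.sqrt ((n : ℝ)⁻¹ * ∑ i, z n i ^ 2)⁻¹) atTop (𝓝 1) := by
      simpa using (h2.inv₀ one_ne_zero).sqrt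
    refine h3.congr' ?_
    filter_upwards [eventually_gt_atTop 0] with n hn
    rw [hz2 n hn, mul_inv, inv_inv, Real.sqrt_mul (Nat.cast_nonneg n), Real.sqrt_inv,
      Real.sqrt_sq (hρ n)]
    rfl
  have hcz : ∀ᶠ n : ℕ in atTop, ∀ i, Real.sqrt n * θ n i = c n * z n i := by
    filter_upwards [hc1.eventually_ne one_ne_zero] with n hn i
    have : ρ n ≠ 0 := fun h => hn (by simp [hc, h])
    rw [hz]
    simp only [hc]
    field_simp
  obtain ⟨T, hTt⟩ := exists_nat_ge (|t| + 1)
  obtain ⟨M, hM⟩ := hT (T + 1)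
  have hM0 : 0 ≤ M := ge_of_tendsto' hM fun n => by positivity
  rw [Metric.tendsto_atTop']
  intro ε hε
  set δ := min 1 (ε / (3 * (K + 1) * (M + 1))) with hδ
  have hδ0 : 0 < δ := by positivity
  obtain ⟨η, hη0, hη⟩ := Metric.continuous_iff.1 hΨ t (ε / 3) (by positivity)
  obtain ⟨r, hr1, hr2⟩ := exists_rat_btwn (show t < t + min η δ by
    have := lt_min hη0 hδ0
    linarith)
  have hrη : |(r : ℝ) - t| < η := by
    rw [abs_of_pos (by linarith)]; linarith [min_le_left η δ]
  have hrδ : |t - (r : ℝ)| < δ := by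
    rw [abs_sub_comm, abs_of_pos (by linarith)]; linarith [min_le_right η δ]
  have htc : Tendsto (fun n => t * c n) atTop (𝓝 t) := by simpa using hc1.const_mul t
  have e1 : ∀ᶠ n in atTop, |t * c n - r| < δ := by
    have : Tendsto (fun n => |t * c n - r|) atTop (𝓝 |t - r|) := (htc.sub_const _).abs
    exact this.eventually_lt_const hrδ
  have e2 : ∀ᶠ n in atTop, |t * c n| < |t| + 1 := htc.abs.eventually_lt_const (by linarith)
  have e3 := hM.eventually_lt_const (show M < M + 1 by linarith)
  have e4 := (Metric.tendsto_nhds.1 (hr r)) (ε / 3) (by positivity)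
  have key : ∀ᶠ n : ℕ in atTop,
      dist ((n : ℝ)⁻¹ * ∑ i, Λ (t * (Real.sqrt n * θ n i))) (Ψ t) < ε := by
    filter_upwards [hcz, e1, e2, e3, e4] with n hn h1 h2 h3 h4
    have hrT : |(r : ℝ)| ≤ T := by
      have := abs_sub_abs_le_abs_sub (r : ℝ) t
      rw [abs_sub_comm] at this
      linarith [min_le_left 1 (ε / (3 * (K + 1) * (M + 1)))]
    have hdiff : |(n : ℝ)⁻¹ * ∑ i, Λ (t * (Real.sqrt n * θ n i))
        - (n : ℝ)⁻¹ * ∑ i, Λ (r * z n i)| ≤ K * δ * (M + 1) := by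
      rw [← mul_sub, ← Finset.sum_sub_distrib, abs_mul, abs_of_nonneg (by positivity)]
      calc (n : ℝ)⁻¹ * |∑ i, (Λ (t * (Real.sqrt n * θ n i)) - Λ (r * z n i))|
          ≤ (n : ℝ)⁻¹ * ∑ i, K * δ * Real.exp ((T + 1 : ℕ) * |z n i|) := by
            refine mul_le_mul_of_nonneg_left ((Finset.abs_sum_le_sum_abs _ _).trans
              (Finset.sum_le_sum fun i _ => ?_)) (by positivity)
            rw [hn i, ← mul_assoc]
            refine (abs_sub_le_of_deriv_bound hd hK' (T := T) (by linarith) hrT _).trans ?_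
            push_cast
            gcongr
        _ = K * δ * ((n : ℝ)⁻¹ * ∑ i, Real.exp ((T + 1 : ℕ) * |z n i|)) := by
            rw [← Finset.mul_sum]; ring
        _ ≤ K * δ * (M + 1) := by gcongr
    have hδε : K * δ * (M + 1) ≤ ε / 3 := by
      have h5 : δ * (3 * (K + 1) * (M + 1)) ≤ ε := by
        rw [← le_div_iff₀ (by positivity)]
        exact min_le_right _ _
      have : 0 ≤ δ * (M + 1) := by positivity
      nlinarith
    have h6 := hη r hrη
    rw [Real.dist_eq] at h4 h6 ⊢
    rw [abs_lt] at h4 h6 ⊢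
    rw [abs_le] at hdiff
    constructor <;> linarith [hdiff.1, hdiff.2, h4.1, h4.2, h6.1, h6.2]
  obtain ⟨N, hN⟩ := eventually_atTop.1 key
  exact ⟨N, fun n hn => hN n hn.le⟩

/-- Almost surely, averages over the rescaled coordinates of uniform points on the spheres converge
to Gaussian integrals. -/
lemma ae_tendsto_average_sphere {Λ : ℝ → ℝ} {K : ℝ} (hd : Differentiable ℝ Λ)
    (hK : ∀ s, |Λ s| ≤ K * Real.exp |s|) (hK' : ∀ s, |deriv Λ s| ≤ K * Real.exp |s|)
    (σ : Measure ((n : ℕ) → Fin n → ℝ)) [IsProbabilityMeasure σ]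
    (hσ : ∀ n, 0 < n → IsUniformSphere (Measure.map (fun θ => θ n) σ)) :
    ∀ᵐ θ ∂σ, ∀ t : ℝ, Tendsto (fun n : ℕ => (n : ℝ)⁻¹ * ∑ i, Λ (t * (Real.sqrt n * θ n i))) atTop
      (𝓝 (∫ u, Λ (t * u) ∂(gaussianReal 0 1))) := by
  set G : Measure ((n : ℕ) → Fin n → ℝ) :=
    Measure.infinitePi fun n => Measure.pi fun _ : Fin n => gaussianReal 0 1 with hG
  set Z : (n : ℕ) → ((n : ℕ) → Fin n → ℝ) × ((n : ℕ) → Fin n → ℝ) → Fin n → ℝ :=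
    fun n p => Real.sqrt (∑ i, p.2 n i ^ 2) • p.1 n with hZ
  have hZm : ∀ n, Measurable (Z n) := fun n => by fun_prop
  have hlaw : ∀ n, 0 < n → (σ.prod G).map (Z n) = Measure.pi fun _ => gaussianReal 0 1 := by
    intro n hn
    have e1 : (σ.prod G).map (Prod.map (fun θ => θ n) fun g => g n)
        = (σ.map fun θ => θ n).prod (Measure.pi fun _ : Fin n => gaussianReal 0 1) := by
      rw [← Measure.map_prod_map _ _ (by fun_prop) (by fun_prop)]
      congr 1
      exact Measure.infinitePi_map_eval _ n
    rw [← (hσ n hn).map_prod_smul, ← e1, Measure.map_map (by fun_prop) (by fun_prop)]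
    rfl
  have hS : ∀ᵐ θ ∂σ, ∀ n, 0 < n → ∑ i, θ n i ^ 2 = 1 := by
    refine ae_all_iff.2 fun n => ?_
    by_cases hn : 0 < n
    · have hms : MeasurableSet (unitSphereSet n) :=
        measurableSet_eq_fun (by fun_prop) measurable_const
      have := (hσ n hn).1
      have h1 : ∀ᵐ x ∂(σ.map fun θ => θ n), x ∈ unitSphereSet n :=
        (prob_compl_eq_zero_iff hms).2 (hσ n hn).2.1
      filter_upwards [ae_of_ae_map (measurable_pi_apply n).aemeasurable h1] with θ hθ _ using hθ
    · exact ae_of_all _ fun θ h => absurd h hn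
  have hΛ := ae_all_iff.2 fun r : ℚ => ae_tendsto_average hZm hlaw (f := fun u => Λ (r * u))
    (hd.continuous.comp (by fun_prop)).measurable (memLp_comp_mul_gaussian hd hK r)
  have hE := ae_all_iff.2 fun T : ℕ => ae_tendsto_average hZm hlaw
    (f := fun u => Real.exp (T * |u|)) (by fun_prop) (memLp_exp_mul_abs_gaussian T)
  have h2 := ae_tendsto_average hZm hlaw (f := fun u => u ^ 2) (by fun_prop)
    (((memLp_exp_mul_abs_gaussian 1).const_mul 2).mono (by fun_prop) (ae_of_all _ fun u => by
      have := Real.pow_div_factorial_le_exp |u| (abs_nonneg u) 2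
      rw [div_le_iff₀ (by positivity), sq_abs] at this
      rw [Real.norm_eq_abs, Real.norm_eq_abs, abs_of_nonneg (sq_nonneg u),
        abs_of_nonneg (by positivity), one_mul]
      simpa [mul_comm] using this))
  have hvar : ∫ u, u ^ 2 ∂(gaussianReal 0 1) = 1 := by
    have := variance_id_gaussianReal (μ := 0) (v := 1)
    rw [variance_eq_integral aemeasurable_id] at this
    simpa using this
  rw [hvar] at h2
  filter_upwards [hS, Measure.ae_ae_of_ae_prod (hΛ.and (hE.and h2))] with θ hθ hg t
  obtain ⟨g, hg1, hg2, hg3⟩ := hg.exists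
  exact tendsto_average_of_gaussian hd hK' (z := fun n => Z n (θ, g))
    (Ψ := fun t => ∫ u, Λ (t * u) ∂(gaussianReal 0 1))
    (ρ := fun n => Real.sqrt (∑ i, g n i ^ 2))
    (differentiable_integral_comp_mul_gaussian hd hK hK').continuous
    (fun n => Real.sqrt_nonneg _) (fun n i => rfl) hθ hg3 hg1 (fun T => ⟨_, hg2 T⟩) t

end SphereAverage

section ProductMeasure

variable {Ω : Type*} [MeasurableSpace Ω] {P : Measure Ω}
  {γ : Measure ℝ} [IsProbabilityMeasure γ] {n : ℕ} {X : Ω → Fin n → ℝ}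

lemma exp_mul_dotp (s : ℝ) (x θ : Fin n → ℝ) :
    Real.exp (s * dotp x θ) = ∏ i, Real.exp (s * θ i * x i) := by
  rw [← Real.exp_sum, dotp, Finset.mul_sum]
  congr 1
  exact Finset.sum_congr rfl fun i _ => by ring

lemma integrable_exp_mul_dotp (hX : Measurable X) (hlaw : P.map X = Measure.pi fun _ => γ)
    (hint : ∀ t, Integrable (fun y => Real.exp (t * y)) γ) (θ : Fin n → ℝ) (s : ℝ) :
    Integrable (fun ω => Real.exp (s * dotp (X ω) θ)) P := by
  have h : Integrable (fun x : Fin n → ℝ => ∏ i, Real.exp (s * θ i * x i)) (P.map X) := by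
    rw [hlaw]
    exact Integrable.fintype_prod fun i => hint (s * θ i)
  simp only [exp_mul_dotp]
  exact h.comp_measurable hX

lemma cgf_dotp (hX : Measurable X) (hlaw : P.map X = Measure.pi fun _ => γ)
    (hint : ∀ t, Integrable (fun y => Real.exp (t * y)) γ) (θ : Fin n → ℝ) (s : ℝ) :
    cgf (fun ω => dotp (X ω) θ) P s = ∑ i, cgf id γ (s * θ i) := by
  have h : mgf (fun ω => dotp (X ω) θ) P s = ∏ i, mgf id γ (s * θ i) := by
    simp only [mgf, exp_mul_dotp]
    rw [← integral_map (f := fun x : Fin n → ℝ => ∏ i, Real.exp (s * θ i * x i))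
      hX.aemeasurable (Measurable.aestronglyMeasurable (by fun_prop)), hlaw]
    exact integral_fintype_prod_eq_prod fun i y => Real.exp (s * θ i * y)
  rw [cgf, h, Real.log_prod fun i _ => (mgf_pos (X := id) (hint _)).ne']
  rfl

end ProductMeasure

/-- Quenched LDP for product measures `γ ∈ 𝒯_q`, `q > 1`. -/
theorem statement11
    (γ : Measure ℝ) [IsProbabilityMeasure γ] (q : ℝ) (hq : 1 < q) (hγ : memT q γ)
    {Ω : Type*} [MeasurableSpace Ω] (P : Measure Ω) [IsProbabilityMeasure P]
    (X : (n : ℕ) → Ω → (Fin n → ℝ))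
    (hXmeas : ∀ n, Measurable (X n))
    (hX : ∀ n, Measure.map (X n) P = Measure.pi (fun _ : Fin n => γ))
    (σ : Measure ((n : ℕ) → Fin n → ℝ)) [IsProbabilityMeasure σ]
    (hσ : ∀ n, 0 < n → IsUniformSphere (Measure.map (fun θ => θ n) σ)) :
    (∀ᵐ θ ∂σ, IsLDP P (fun n ω => (n : ℝ) ^ (-(1:ℝ)/2) * dotp (X n ω) (θ n))
        (fun n => (n : ℝ)) (Iqg γ (muP 2)))
    ∧ ConvexRate (Iqg γ (muP 2))
    ∧ HasCompactSublevels (Iqg γ (muP 2)) := by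
  obtain ⟨K, hK, hK'⟩ := exists_cgf_bound_of_memT hq hγ
  have hd := differentiable_cgf_of_memT hγ
  have hint := integrable_exp_mul_of_memT hγ
  set Ψ : ℝ → ℝ := fun t => ∫ u, cgf id γ (t * u) ∂(gaussianReal 0 1) with hΨ
  have hrate : Iqg γ (muP 2) = legendre1 fun t => (Ψ t : EReal) := by
    rw [Iqg, muP_two]
    congr 1
    ext t
    simp only [Psig, logM_eq_cgf hγ]
    exact eIntegral_coe (integrable_comp_mul_gaussian hd hK t)
  have h0 : Ψ 0 = 0 := by simp [hΨ]
  have hpos : ∀ t, 0 ≤ Ψ t := by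
    intro t
    have h1 : ∀ u, deriv (cgf id γ) 0 * t * u ≤ cgf id γ (t * u) := fun u => by
      have := add_deriv_mul_le_of_convexOn (convexOn_cgf_of_memT hγ) hd 0 (t * u)
      simpa [mul_assoc] using this
    have h2 : Integrable (fun u : ℝ => u) (gaussianReal 0 1) :=
      (memLp_id_gaussianReal 1).integrable le_rfl
    have h3 := integral_mono (h2.const_mul (deriv (cgf id γ) 0 * t))
      (integrable_comp_mul_gaussian hd hK t) h1
    rw [integral_const_mul, integral_id_gaussianReal, mul_zero] at h3
    exact h3
  rw [hrate]
  refine ⟨?_, convexRate_legendre1 h0, hasCompactSublevels_legendre1⟩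
  filter_upwards [ae_tendsto_average_sphere hd hK hK' σ hσ] with θ hθ
  refine isLDP_of_tendsto_cgf (fun n => ?_) (fun n t => ?_) (fun t => ?_) h0 hpos
    (differentiable_integral_comp_mul_gaussian hd hK hK')
  · have := hXmeas n
    unfold dotp
    fun_prop
  · simp only [← mul_assoc]
    exact integrable_exp_mul_dotp (hXmeas n) (hX n) hint (θ n) _
  · refine (hθ t).congr' ?_
    filter_upwards [eventually_gt_atTop 0] with n hn
    have hn' : (0 : ℝ) < n := by exact_mod_cast hn
    congr 1
    rw [cgf, mgf_const_mul, ← cgf, cgf_dotp (hXmeas n) (hX n) hint]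
    refine Finset.sum_congr rfl fun i _ => ?_
    congr 1
    have : Real.sqrt n = (n : ℝ) ^ (-(1 : ℝ) / 2) * n := by
      rw [Real.sqrt_eq_rpow]
      nth_rewrite 3 [← Real.rpow_one (n : ℝ)]
      rw [← Real.rpow_add hn']
      norm_num
    rw [this]
    ring
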